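/- arXiv:2308.06500 — 11 statements merged into one kernel-verified Lean document; each statement's English description precedes it below -/
import Mathlib

section
/- Let X be a real interval, let g, h : X → ℝ be continuous and strictly monotone on X, let n ≥ 2, x₁, …, xₙ ∈ X, and p₁, …, pₙ positive weights with ∑ᵢ pᵢ = 1. Let yᵢ = h(xᵢ) and D = [min yᵢ, max yᵢ]. Denote by ξ_g and ξ_h the isomorphic weighted means of the xᵢ generated by g and by h respectively. Then: (1) if g is increasing on X and g ∘ h⁻¹ is convex on D, then ξ_g ≥ ξ_h; (2) if g is increasing on X and g ∘ h⁻¹ is concave on D, then ξ_g ≤ ξ_h; (3) if g is decreasing on X and g ∘ h⁻¹ is convex on D, then ξ_g ≤ ξ_h; (4) if g is decreasing on X and g ∘ h⁻¹ is concave on D, then ξ_g ≥ ξ_h. Moreover, in each case, if the convexity/concavity of g ∘ h⁻¹ is strict and the xᵢ are not all equal, the corresponding inequality is strict. -/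
/-- comparison of two isomorphic weighted means of numbers via
convexity/concavity of `g ∘ h⁻¹` (here `φ`, with `φ (h t) = g t` on `X`). -/
theorem stmt_1 {X : Set ℝ} (hX : X.OrdConnected) {g h : ℝ → ℝ}
    (hg_cont : ContinuousOn g X) (hh_cont : ContinuousOn h X)
    (hg_mono : StrictMonoOn g X ∨ StrictAntiOn g X)
    (hh_mono : StrictMonoOn h X ∨ StrictAntiOn h X)
    {n : ℕ} (hn : 2 ≤ n) (x : Fin n → ℝ) (hx : ∀ i, x i ∈ X)
    (p : Fin n → ℝ) (hp : ∀ i, 0 < p i) (hps : ∑ i, p i = 1)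
    (φ : ℝ → ℝ) (hφ : ∀ t ∈ X, φ (h t) = g t)
    (D : Set ℝ)
    (hD : D = Set.Icc
      (Finset.univ.inf' ⟨⟨0, by omega⟩, Finset.mem_univ _⟩ (fun i => h (x i)))
      (Finset.univ.sup' ⟨⟨0, by omega⟩, Finset.mem_univ _⟩ (fun i => h (x i))))
    (ξg ξh : ℝ) (hξgX : ξg ∈ X) (hξhX : ξh ∈ X)
    (hξg : g ξg = ∑ i, p i * g (x i)) (hξh : h ξh = ∑ i, p i * h (x i)) :
    (StrictMonoOn g X → ConvexOn ℝ D φ → ξh ≤ ξg) ∧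
    (StrictMonoOn g X → ConcaveOn ℝ D φ → ξg ≤ ξh) ∧
    (StrictAntiOn g X → ConvexOn ℝ D φ → ξg ≤ ξh) ∧
    (StrictAntiOn g X → ConcaveOn ℝ D φ → ξh ≤ ξg) ∧
    (StrictMonoOn g X → StrictConvexOn ℝ D φ → (¬ ∀ i j, x i = x j) → ξh < ξg) ∧
    (StrictMonoOn g X → StrictConcaveOn ℝ D φ → (¬ ∀ i j, x i = x j) → ξg < ξh) ∧
    (StrictAntiOn g X → StrictConvexOn ℝ D φ → (¬ ∀ i j, x i = x j) → ξg < ξh) ∧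
    (StrictAntiOn g X → StrictConcaveOn ℝ D φ → (¬ ∀ i j, x i = x j) → ξh < ξg) := by
  have hmem : ∀ i ∈ Finset.univ, h (x i) ∈ D := fun i hi => by
    rw [hD]
    exact ⟨Finset.inf'_le (fun i => h (x i)) hi, Finset.le_sup' (fun i => h (x i)) hi⟩
  have hp0 : ∀ i ∈ Finset.univ, 0 ≤ p i := fun i _ => (hp i).le
  have hpos : ∀ i ∈ Finset.univ, 0 < p i := fun i _ => hp i
  have hφh : φ (∑ i, p i • h (x i)) = g ξh := by
    simp only [smul_eq_mul]
    rw [← hξh, hφ _ hξhX]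
  have hφg : ∑ i, p i • φ (h (x i)) = g ξg := by
    simp only [hφ _ (hx _), smul_eq_mul, hξg]
  have hinj : Set.InjOn h X := hh_mono.elim StrictMonoOn.injOn StrictAntiOn.injOn
  have hne : (¬ ∀ i j, x i = x j) → ∃ j ∈ Finset.univ, ∃ k ∈ Finset.univ, h (x j) ≠ h (x k) := by
    intro H
    push Not at H
    obtain ⟨i, j, hij⟩ := H
    exact ⟨i, Finset.mem_univ _, j, Finset.mem_univ _,
      fun e => hij (hinj (hx i) (hx j) e)⟩
  have convex_le (hc : ConvexOn ℝ D φ) : g ξh ≤ g ξg := by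
    simpa only [hφh, hφg] using hc.map_sum_le hp0 hps hmem
  have concave_le (hc : ConcaveOn ℝ D φ) : g ξg ≤ g ξh := by
    simpa only [hφh, hφg] using hc.le_map_sum hp0 hps hmem
  have convex_lt (hc : StrictConvexOn ℝ D φ) (H : ¬ ∀ i j, x i = x j) : g ξh < g ξg := by
    obtain ⟨j, hj, k, hk, hjk⟩ := hne H
    simpa only [hφh, hφg] using hc.map_sum_lt hpos hps hmem ⟨j, hj, k, hk, hjk⟩
  have concave_lt (hc : StrictConcaveOn ℝ D φ) (H : ¬ ∀ i j, x i = x j) : g ξg < g ξh := by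
    obtain ⟨j, hj, k, hk, hjk⟩ := hne H
    simpa only [hφh, hφg] using hc.lt_map_sum hpos hps hmem ⟨j, hj, k, hk, hjk⟩
  exact ⟨fun m c => (m.le_iff_le hξhX hξgX).1 (convex_le c),
    fun m c => (m.le_iff_le hξgX hξhX).1 (concave_le c),
    fun m c => (m.le_iff_ge hξhX hξgX).1 (convex_le c),
    fun m c => (m.le_iff_ge hξgX hξhX).1 (concave_le c),
    fun m c H => (m.lt_iff_lt hξhX hξgX).1 (convex_lt c H),
    fun m c H => (m.lt_iff_lt hξgX hξhX).1 (concave_lt c H),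
    fun m c H => (m.lt_iff_gt hξhX hξgX).1 (convex_lt c H),
    fun m c H => (m.lt_iff_gt hξgX hξhX).1 (concave_lt c H)⟩
end

section
/- Let X be a real interval on which g and h are strictly monotone and differentiable with g'(x) ≠ 0 and h'(x) ≠ 0 for all x ∈ X. Let n ≥ 2, x₁, …, xₙ ∈ X, and p₁, …, pₙ positive weights with ∑ᵢ pᵢ = 1. Denote by ξ_g and ξ_h the isomorphic weighted means of the xᵢ generated by g and by h respectively. Then: (1) if |g'/h'| is strictly increasing on X, then ξ_g ≥ ξ_h, with equality only if the xᵢ are all equal; (2) if |g'/h'| is strictly decreasing on X, then ξ_g ≤ ξ_h, with equality only if the xᵢ are all equal. -/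
/-- Absolute-value form of Cauchy's mean value theorem for strictly increasing functions. -/
theorem exists_sub_eq_abs_deriv_ratio_mul {X : Set ℝ} (hX : X.OrdConnected) {g h g' h' : ℝ → ℝ}
    (hg_mono : StrictMonoOn g X) (hh_mono : StrictMonoOn h X)
    (hg' : ∀ t ∈ X, HasDerivWithinAt g (g' t) X t)
    (hh' : ∀ t ∈ X, HasDerivWithinAt h (h' t) X t)
    (hh'0 : ∀ t ∈ X, h' t ≠ 0) {a b : ℝ} (ha : a ∈ X) (hb : b ∈ X) (hab : a < b) :
    ∃ c ∈ Set.Ioo a b, g b - g a = |g' c / h' c| * (h b - h a) := by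
  have hsub : Set.Icc a b ⊆ X := hX.out ha hb
  have key {f f' : ℝ → ℝ} (hf : ∀ t ∈ X, HasDerivWithinAt f (f' t) X t) :
      ContinuousOn f (Set.Icc a b) ∧ ∀ t ∈ Set.Ioo a b, HasDerivAt f (f' t) t :=
    ⟨fun t ht => (hf t (hsub ht)).continuousWithinAt.mono hsub, fun t ht =>
      (hf t (hsub (Set.Ioo_subset_Icc_self ht))).hasDerivAt
        (Filter.mem_of_superset (Icc_mem_nhds ht.1 ht.2) hsub)⟩
  obtain ⟨c, hc, hcauchy⟩ := exists_ratio_hasDerivAt_eq_ratio_slope g g' hab (key hg').1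
    (key hg').2 h h' (key hh').1 (key hh').2
  refine ⟨c, hc, ?_⟩
  have hg_pos := sub_pos.2 (hg_mono ha hb hab)
  have hh_pos := sub_pos.2 (hh_mono ha hb hab)
  have hc0 := hh'0 c (hsub (Set.Ioo_subset_Icc_self hc))
  have hratio : g' c / h' c = (g b - g a) / (h b - h a) := by
    rw [div_eq_div_iff hc0 hh_pos.ne']
    linarith
  rw [hratio, abs_of_pos (div_pos hg_pos hh_pos), div_mul_cancel₀ _ hh_pos.ne']

theorem abs_deriv_ratio_mul_sub_lt_sub {X : Set ℝ} (hX : X.OrdConnected) {g h g' h' : ℝ → ℝ}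
    (hg_mono : StrictMonoOn g X) (hh_mono : StrictMonoOn h X)
    (hg' : ∀ t ∈ X, HasDerivWithinAt g (g' t) X t)
    (hh' : ∀ t ∈ X, HasDerivWithinAt h (h' t) X t)
    (hh'0 : ∀ t ∈ X, h' t ≠ 0) (hK : StrictMonoOn (fun t => |g' t / h' t|) X)
    {c y : ℝ} (hc : c ∈ X) (hy : y ∈ X) (hne : y ≠ c) :
    |g' c / h' c| * (h y - h c) < g y - g c := by
  rcases hne.lt_or_gt with hlt | hlt
  · obtain ⟨t, ht, heq⟩ :=
      exists_sub_eq_abs_deriv_ratio_mul hX hg_mono hh_mono hg' hh' hh'0 hy hc hlt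
    have hKt := hK (hX.out hy hc (Set.Ioo_subset_Icc_self ht)) hc ht.2
    have := mul_lt_mul_of_pos_right hKt (sub_pos.2 (hh_mono hy hc hlt))
    simp only at this
    linarith
  · obtain ⟨t, ht, heq⟩ :=
      exists_sub_eq_abs_deriv_ratio_mul hX hg_mono hh_mono hg' hh' hh'0 hc hy hlt
    rw [heq]
    exact mul_lt_mul_of_pos_right (hK hc (hX.out hc hy (Set.Ioo_subset_Icc_self ht)) ht.1)
      (sub_pos.2 (hh_mono hc hy hlt))

theorem weighted_mean_le_of_strictMonoOn {X : Set ℝ} (hX : X.OrdConnected) {g h g' h' : ℝ → ℝ}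
    (hg_mono : StrictMonoOn g X) (hh_mono : StrictMonoOn h X)
    (hg' : ∀ t ∈ X, HasDerivWithinAt g (g' t) X t)
    (hh' : ∀ t ∈ X, HasDerivWithinAt h (h' t) X t)
    (hh'0 : ∀ t ∈ X, h' t ≠ 0) (hK : StrictMonoOn (fun t => |g' t / h' t|) X)
    {ι : Type*} [Fintype ι] {x : ι → ℝ} (hx : ∀ i, x i ∈ X)
    {p : ι → ℝ} (hp : ∀ i, 0 < p i) (hps : ∑ i, p i = 1)
    {ξg ξh : ℝ} (hξgX : ξg ∈ X) (hξhX : ξh ∈ X)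
    (hξg : g ξg = ∑ i, p i * g (x i)) (hξh : h ξh = ∑ i, p i * h (x i)) :
    ξh ≤ ξg ∧ (ξh = ξg → ∀ i j, x i = x j) := by
  have hlt (i) (hi : x i ≠ ξh) :=
    abs_deriv_ratio_mul_sub_lt_sub hX hg_mono hh_mono hg' hh' hh'0 hK hξhX (hx i) hi
  set k := |g' ξh / h' ξh|
  have hle (i) : 0 ≤ p i * (g (x i) - g ξh - k * (h (x i) - h ξh)) := by
    refine mul_nonneg (hp i).le ?_
    by_cases hi : x i = ξh
    · simp [hi]
    · linarith [hlt i hi]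
  have hsum : ∑ i, p i * (g (x i) - g ξh - k * (h (x i) - h ξh)) = g ξg - g ξh := by
    calc
      _ = ∑ i, (p i * g (x i) - p i * g ξh - k * (p i * h (x i) - p i * h ξh)) :=
        Finset.sum_congr rfl fun i _ => by ring
      _ = g ξg - g ξh := by
        rw [Finset.sum_sub_distrib, ← Finset.mul_sum, Finset.sum_sub_distrib,
          Finset.sum_sub_distrib, ← Finset.sum_mul, ← Finset.sum_mul, hps, ← hξg, ← hξh]
        ring
  constructor
  · rw [← hg_mono.le_iff_le hξhX hξgX, ← sub_nonneg, ← hsum]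
    exact Finset.sum_nonneg fun i _ => hle i
  · intro heq
    rw [heq, sub_self, ← heq, Finset.sum_eq_zero_iff_of_nonneg fun i _ => hle i] at hsum
    have hall (i) : x i = ξh := by
      by_contra hi
      have := (mul_eq_zero.1 (hsum i (Finset.mem_univ i))).resolve_left (hp i).ne'
      linarith [hlt i hi]
    intro i j
    rw [hall i, hall j]

theorem weighted_mean_le {X : Set ℝ} (hX : X.OrdConnected) {g h g' h' : ℝ → ℝ}
    (hg_mono : StrictMonoOn g X ∨ StrictAntiOn g X)
    (hh_mono : StrictMonoOn h X ∨ StrictAntiOn h X)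
    (hg' : ∀ t ∈ X, HasDerivWithinAt g (g' t) X t)
    (hh' : ∀ t ∈ X, HasDerivWithinAt h (h' t) X t)
    (hh'0 : ∀ t ∈ X, h' t ≠ 0) (hK : StrictMonoOn (fun t => |g' t / h' t|) X)
    {ι : Type*} [Fintype ι] {x : ι → ℝ} (hx : ∀ i, x i ∈ X)
    {p : ι → ℝ} (hp : ∀ i, 0 < p i) (hps : ∑ i, p i = 1)
    {ξg ξh : ℝ} (hξgX : ξg ∈ X) (hξhX : ξh ∈ X)
    (hξg : g ξg = ∑ i, p i * g (x i)) (hξh : h ξh = ∑ i, p i * h (x i)) :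
    ξh ≤ ξg ∧ (ξh = ξg → ∀ i j, x i = x j) := by
  wlog hg : StrictMonoOn g X generalizing g g'
  · exact this (g := -g) (g' := -g') (.inl (hg_mono.resolve_left hg).neg)
      (fun t ht => (hg' t ht).neg) (by simpa [neg_div] using hK) (by simp [hξg])
      (hg_mono.resolve_left hg).neg
  wlog hh : StrictMonoOn h X generalizing h h'
  · exact this (h := -h) (h' := -h') (.inl (hh_mono.resolve_left hh).neg)
      (fun t ht => (hh' t ht).neg) (by simpa using hh'0) (by simp [hξh])
      (by simpa [div_neg] using hK) (hh_mono.resolve_left hh).neg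
  exact weighted_mean_le_of_strictMonoOn hX hg hh hg' hh' hh'0 hK hx hp hps hξgX hξhX hξg hξh


/-- differential criteria for comparing two isomorphic weighted
means of numbers: monotonicity of `|g'/h'|` decides the inequality. -/
theorem stmt_2 {X : Set ℝ} (hX : X.OrdConnected) {g h g' h' : ℝ → ℝ}
    (hg_mono : StrictMonoOn g X ∨ StrictAntiOn g X)
    (hh_mono : StrictMonoOn h X ∨ StrictAntiOn h X)
    (hg' : ∀ t ∈ X, HasDerivWithinAt g (g' t) X t)
    (hh' : ∀ t ∈ X, HasDerivWithinAt h (h' t) X t)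
    (hg'0 : ∀ t ∈ X, g' t ≠ 0) (hh'0 : ∀ t ∈ X, h' t ≠ 0)
    {n : ℕ} (hn : 2 ≤ n) (x : Fin n → ℝ) (hx : ∀ i, x i ∈ X)
    (p : Fin n → ℝ) (hp : ∀ i, 0 < p i) (hps : ∑ i, p i = 1)
    (ξg ξh : ℝ) (hξgX : ξg ∈ X) (hξhX : ξh ∈ X)
    (hξg : g ξg = ∑ i, p i * g (x i)) (hξh : h ξh = ∑ i, p i * h (x i)) :
    (StrictMonoOn (fun t => |g' t / h' t|) X →
      ξh ≤ ξg ∧ (ξh = ξg → ∀ i j, x i = x j)) ∧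
    (StrictAntiOn (fun t => |g' t / h' t|) X →
      ξg ≤ ξh ∧ (ξg = ξh → ∀ i j, x i = x j)) := by
  refine ⟨fun hK => weighted_mean_le hX hg_mono hh_mono hg' hh' hh'0 hK hx hp hps hξgX hξhX
    hξg hξh, fun hK => weighted_mean_le hX hh_mono hg_mono hh' hg' hg'0 ?_ hx hp hps hξhX hξgX
    hξh hξg⟩
  intro s hs t ht hst
  have hlt := inv_strictAnti₀ (abs_pos.2 (div_ne_zero (hg'0 t ht) (hh'0 t ht))) (hK hs ht hst)
  simpa only [← abs_inv, inv_div] using hlt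
end

section
/- Let g, h be strictly monotone, continuous and differentiable functions on an open interval X with g'(x) ≠ 0 and h'(x) ≠ 0 for all x ∈ X, and suppose h'/g' is strictly monotone on X. Let n ≥ 2, x₁, …, xₙ ∈ X, and p₁, …, pₙ positive weights with ∑ᵢ pᵢ = 1, and denote by ξ_g and ξ_h the isomorphic weighted means of the xᵢ generated by g and by h. Among the three functions h'/g', h, g: (1) if an odd number of them (exactly one or all three) are strictly increasing (and the remaining ones strictly decreasing), then ξ_g ≤ ξ_h; (2) if an odd number of them (exactly one or all three) are strictly decreasing (and the remaining ones strictly increasing), then ξ_g ≥ ξ_h. In both cases equality holds only if the xᵢ are all equal. -/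
/-- Cauchy's mean value theorem on an order-connected set, in quotient form. -/
theorem exists_sub_eq_mul_div_deriv {X : Set ℝ} (hX : X.OrdConnected) {g h g' h' : ℝ → ℝ}
    (hg' : ∀ t ∈ X, HasDerivAt g (g' t) t) (hh' : ∀ t ∈ X, HasDerivAt h (h' t) t)
    (hg'0 : ∀ t ∈ X, g' t ≠ 0) {a b : ℝ} (ha : a ∈ X) (hb : b ∈ X) (hab : a < b) :
    ∃ s ∈ X, a < s ∧ s < b ∧ h b - h a = (g b - g a) * (h' s / g' s) := by
  have hsub : Set.Icc a b ⊆ X := hX.out ha hb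
  obtain ⟨s, hs, e⟩ := exists_ratio_hasDerivAt_eq_ratio_slope h h' hab
    (fun t ht => (hh' t (hsub ht)).continuousAt.continuousWithinAt)
    (fun t ht => hh' t (hsub (Set.Ioo_subset_Icc_self ht))) g g'
    (fun t ht => (hg' t (hsub ht)).continuousAt.continuousWithinAt)
    (fun t ht => hg' t (hsub (Set.Ioo_subset_Icc_self ht)))
  have hsX : s ∈ X := hsub (Set.Ioo_subset_Icc_self hs)
  have h0 := hg'0 s hsX
  refine ⟨s, hsX, hs.1, hs.2, ?_⟩
  field_simp
  linarith

/-- If `g` and `h' / g'` are strictly increasing, then `h` is a strictly convex function of `g`: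
its values lie above the tangent at `c`. -/
theorem tangent_lt_of_strictMonoOn {X : Set ℝ} (hX : X.OrdConnected) {g h g' h' : ℝ → ℝ}
    (hg' : ∀ t ∈ X, HasDerivAt g (g' t) t) (hh' : ∀ t ∈ X, HasDerivAt h (h' t) t)
    (hg'0 : ∀ t ∈ X, g' t ≠ 0) (hg : StrictMonoOn g X)
    (hr : StrictMonoOn (fun t => h' t / g' t) X) {c t : ℝ} (hc : c ∈ X) (ht : t ∈ X)
    (hne : t ≠ c) : h c + h' c / g' c * (g t - g c) < h t := by
  rcases lt_or_gt_of_ne hne with hlt | hlt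
  · obtain ⟨s, hs, _, hsc, e⟩ := exists_sub_eq_mul_div_deriv hX hg' hh' hg'0 ht hc hlt
    nlinarith [mul_pos (sub_pos.2 (hg ht hc hlt)) (sub_pos.2 (hr hs hc hsc))]
  · obtain ⟨s, hs, hcs, _, e⟩ := exists_sub_eq_mul_div_deriv hX hg' hh' hg'0 hc ht hlt
    nlinarith [mul_pos (sub_pos.2 (hg hc ht hlt)) (sub_pos.2 (hr hc hs hcs))]

/-- Jensen's inequality for `h` as a function of `g`, with the equality case. -/
theorem le_weighted_sum_of_strictMonoOn {ι : Type*} [Fintype ι] {X : Set ℝ} (hX : X.OrdConnected)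
    {g h g' h' : ℝ → ℝ}
    (hg' : ∀ t ∈ X, HasDerivAt g (g' t) t) (hh' : ∀ t ∈ X, HasDerivAt h (h' t) t)
    (hg'0 : ∀ t ∈ X, g' t ≠ 0) (hg : StrictMonoOn g X)
    (hr : StrictMonoOn (fun t => h' t / g' t) X)
    {x p : ι → ℝ} (hx : ∀ i, x i ∈ X) (hp : ∀ i, 0 < p i) (hps : ∑ i, p i = 1)
    {c : ℝ} (hc : c ∈ X) (hgc : g c = ∑ i, p i * g (x i)) :
    h c ≤ ∑ i, p i * h (x i) ∧ (h c = ∑ i, p i * h (x i) → ∀ i, x i = c) := by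
  have key : ∀ i, x i ≠ c → p i * (h c + h' c / g' c * (g (x i) - g c)) < p i * h (x i) :=
    fun i hi => mul_lt_mul_of_pos_left
      (tangent_lt_of_strictMonoOn hX hg' hh' hg'0 hg hr hc (hx i) hi) (hp i)
  have key' : ∀ i ∈ Finset.univ,
      p i * (h c + h' c / g' c * (g (x i) - g c)) ≤ p i * h (x i) := by
    intro i _
    by_cases hi : x i = c
    · simp [hi]
    · exact (key i hi).le
  have hsum : ∑ i, p i * (h c + h' c / g' c * (g (x i) - g c)) = h c := by
    calc ∑ i, p i * (h c + h' c / g' c * (g (x i) - g c))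
        = ∑ i, (p i * (h c - h' c / g' c * g c) + h' c / g' c * (p i * g (x i))) :=
          Finset.sum_congr rfl fun i _ => by ring
      _ = h c := by
          rw [Finset.sum_add_distrib, ← Finset.sum_mul, ← Finset.mul_sum, hps, ← hgc]
          ring
  refine ⟨hsum.symm.trans_le (Finset.sum_le_sum key'), fun e i => ?_⟩
  by_contra hi
  have := Finset.sum_lt_sum key' ⟨i, Finset.mem_univ i, key i hi⟩
  rw [hsum] at this
  exact this.ne e

/-- The convex case: `g` and `h' / g'` are monotone in the same direction. -/
theorem le_weighted_sum_of_same_monotonicity {ι : Type*} [Fintype ι] {X : Set ℝ}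
    (hX : X.OrdConnected) {g h g' h' : ℝ → ℝ}
    (hg' : ∀ t ∈ X, HasDerivAt g (g' t) t) (hh' : ∀ t ∈ X, HasDerivAt h (h' t) t)
    (hg'0 : ∀ t ∈ X, g' t ≠ 0)
    (hgr : (StrictMonoOn (fun t => h' t / g' t) X ∧ StrictMonoOn g X) ∨
      (StrictAntiOn (fun t => h' t / g' t) X ∧ StrictAntiOn g X))
    {x p : ι → ℝ} (hx : ∀ i, x i ∈ X) (hp : ∀ i, 0 < p i) (hps : ∑ i, p i = 1)
    {c : ℝ} (hc : c ∈ X) (hgc : g c = ∑ i, p i * g (x i)) :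
    h c ≤ ∑ i, p i * h (x i) ∧ (h c = ∑ i, p i * h (x i) → ∀ i, x i = c) := by
  rcases hgr with ⟨hr, hg⟩ | ⟨hr, hg⟩
  · exact le_weighted_sum_of_strictMonoOn hX hg' hh' hg'0 hg hr hx hp hps hc hgc
  · refine le_weighted_sum_of_strictMonoOn (g := fun t => -g t) (g' := fun t => -g' t) hX
      (fun t ht => (hg' t ht).neg) hh' (fun t ht => neg_ne_zero.2 (hg'0 t ht))
      (fun a ha b hb hab => neg_lt_neg (hg ha hb hab)) (fun a ha b hb hab => ?_) hx hp hps hc ?_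
    · simpa only [div_neg] using neg_lt_neg (hr ha hb hab)
    · simp [hgc]

/-- The concave case: `g` and `h' / g'` are monotone in opposite directions. -/
theorem weighted_sum_le_of_opposite_monotonicity {ι : Type*} [Fintype ι] {X : Set ℝ}
    (hX : X.OrdConnected) {g h g' h' : ℝ → ℝ}
    (hg' : ∀ t ∈ X, HasDerivAt g (g' t) t) (hh' : ∀ t ∈ X, HasDerivAt h (h' t) t)
    (hg'0 : ∀ t ∈ X, g' t ≠ 0)
    (hgr : (StrictMonoOn (fun t => h' t / g' t) X ∧ StrictAntiOn g X) ∨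
      (StrictAntiOn (fun t => h' t / g' t) X ∧ StrictMonoOn g X))
    {x p : ι → ℝ} (hx : ∀ i, x i ∈ X) (hp : ∀ i, 0 < p i) (hps : ∑ i, p i = 1)
    {c : ℝ} (hc : c ∈ X) (hgc : g c = ∑ i, p i * g (x i)) :
    ∑ i, p i * h (x i) ≤ h c ∧ (h c = ∑ i, p i * h (x i) → ∀ i, x i = c) := by
  have := le_weighted_sum_of_same_monotonicity (h := fun t => -h t) (h' := fun t => -h' t) hX
    hg' (fun t ht => (hh' t ht).neg) hg'0 ?_ hx hp hps hc hgc
  · simpa only [mul_neg, Finset.sum_neg_distrib, neg_le_neg_iff, neg_inj] using this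
  · simp only [neg_div]
    rcases hgr with ⟨hr, hg⟩ | ⟨hr, hg⟩
    · exact Or.inr ⟨fun a ha b hb hab => neg_lt_neg (hr ha hb hab), hg⟩
    · exact Or.inl ⟨fun a ha b hb hab => neg_lt_neg (hr ha hb hab), hg⟩

/-- Among the three functions `h'/g'`, `h`, `g` on an open
interval `X`, if an odd number of them is strictly increasing then
`ξ_g ≤ ξ_h`, and if an odd number is strictly decreasing then `ξ_g ≥ ξ_h`;
equality only if the `x i` are all equal. -/
theorem stmt_3 {X : Set ℝ} (hXopen : IsOpen X) (hX : X.OrdConnected)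
    {g h g' h' : ℝ → ℝ}
    (hg_cont : ContinuousOn g X) (hh_cont : ContinuousOn h X)
    (hg_mono : StrictMonoOn g X ∨ StrictAntiOn g X)
    (hh_mono : StrictMonoOn h X ∨ StrictAntiOn h X)
    (hg' : ∀ t ∈ X, HasDerivAt g (g' t) t)
    (hh' : ∀ t ∈ X, HasDerivAt h (h' t) t)
    (hg'0 : ∀ t ∈ X, g' t ≠ 0) (hh'0 : ∀ t ∈ X, h' t ≠ 0)
    (hr_mono : StrictMonoOn (fun t => h' t / g' t) X ∨
      StrictAntiOn (fun t => h' t / g' t) X)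
    {n : ℕ} (hn : 2 ≤ n) (x : Fin n → ℝ) (hx : ∀ i, x i ∈ X)
    (p : Fin n → ℝ) (hp : ∀ i, 0 < p i) (hps : ∑ i, p i = 1)
    (ξg ξh : ℝ) (hξgX : ξg ∈ X) (hξhX : ξh ∈ X)
    (hξg : g ξg = ∑ i, p i * g (x i)) (hξh : h ξh = ∑ i, p i * h (x i)) :
    (((StrictMonoOn (fun t => h' t / g' t) X ∧ StrictMonoOn h X ∧ StrictMonoOn g X) ∨
      (StrictMonoOn (fun t => h' t / g' t) X ∧ StrictAntiOn h X ∧ StrictAntiOn g X) ∨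
      (StrictAntiOn (fun t => h' t / g' t) X ∧ StrictMonoOn h X ∧ StrictAntiOn g X) ∨
      (StrictAntiOn (fun t => h' t / g' t) X ∧ StrictAntiOn h X ∧ StrictMonoOn g X)) →
      ξg ≤ ξh ∧ (ξg = ξh → ∀ i j, x i = x j)) ∧
    (((StrictAntiOn (fun t => h' t / g' t) X ∧ StrictAntiOn h X ∧ StrictAntiOn g X) ∨
      (StrictAntiOn (fun t => h' t / g' t) X ∧ StrictMonoOn h X ∧ StrictMonoOn g X) ∨
      (StrictMonoOn (fun t => h' t / g' t) X ∧ StrictAntiOn h X ∧ StrictMonoOn g X) ∨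
      (StrictMonoOn (fun t => h' t / g' t) X ∧ StrictMonoOn h X ∧ StrictAntiOn g X)) →
      ξh ≤ ξg ∧ (ξh = ξg → ∀ i j, x i = x j)) := by
  have convex := fun hgr =>
    le_weighted_sum_of_same_monotonicity hX hg' hh' hg'0 hgr hx hp hps hξgX hξg
  have concave := fun hgr =>
    weighted_sum_le_of_opposite_monotonicity hX hg' hh' hg'0 hgr hx hp hps hξgX hξg
  rw [← hξh] at convex concave
  have all_eq : (h ξg = h ξh → ∀ i, x i = ξg) → ξg = ξh → ∀ i j, x i = x j :=
    fun H e i j => (H (congrArg h e) i).trans (H (congrArg h e) j).symm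
  constructor
  · rintro (⟨hr, hh, hg⟩ | ⟨hr, hh, hg⟩ | ⟨hr, hh, hg⟩ | ⟨hr, hh, hg⟩)
    · have H := convex (.inl ⟨hr, hg⟩)
      exact ⟨(hh.le_iff_le hξgX hξhX).1 H.1, all_eq H.2⟩
    · have H := concave (.inl ⟨hr, hg⟩)
      exact ⟨(hh.le_iff_ge hξhX hξgX).1 H.1, all_eq H.2⟩
    · have H := convex (.inr ⟨hr, hg⟩)
      exact ⟨(hh.le_iff_le hξgX hξhX).1 H.1, all_eq H.2⟩
    · have H := concave (.inr ⟨hr, hg⟩)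
      exact ⟨(hh.le_iff_ge hξhX hξgX).1 H.1, all_eq H.2⟩
  · rintro (⟨hr, hh, hg⟩ | ⟨hr, hh, hg⟩ | ⟨hr, hh, hg⟩ | ⟨hr, hh, hg⟩)
    · have H := convex (.inr ⟨hr, hg⟩)
      exact ⟨(hh.le_iff_ge hξgX hξhX).1 H.1, fun e => all_eq H.2 e.symm⟩
    · have H := concave (.inr ⟨hr, hg⟩)
      exact ⟨(hh.le_iff_le hξhX hξgX).1 H.1, fun e => all_eq H.2 e.symm⟩
    · have H := convex (.inl ⟨hr, hg⟩)
      exact ⟨(hh.le_iff_ge hξgX hξhX).1 H.1, fun e => all_eq H.2 e.symm⟩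
    · have H := concave (.inl ⟨hr, hg⟩)
      exact ⟨(hh.le_iff_le hξhX hξgX).1 H.1, fun e => all_eq H.2 e.symm⟩
end

section
/- Let f : [a,b] → ℝ be continuous on the closed interval [a,b] (a < b), let g be continuous and strictly monotone on [a,b] with inverse g⁻¹ defined on the closed interval E with endpoints g(a) and g(b), and let h be continuous and strictly monotone on [min f, max f] (the range of f). Then there exists a unique y ∈ [min f, max f] such that h(y) = (1/(g(b) − g(a))) · ∫_{g(a)}^{g(b)} h(f(g⁻¹(u))) du; that is, the isomorphic mean of f on [a,b] generated by g, h exists. -/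
/-- A left inverse of a function continuous on a compact set is continuous on the image. -/
theorem IsCompact.continuousOn_leftInvOn {X Y : Type*} [TopologicalSpace X] [TopologicalSpace Y]
    [T2Space Y] {s : Set X} (hs : IsCompact s) {g : X → Y} {k : Y → X}
    (hg : ContinuousOn g s) (hk : Set.LeftInvOn k g s) : ContinuousOn k (g '' s) := by
  rw [continuousOn_iff_isClosed]
  intro t ht
  refine ⟨g '' (s ∩ t),
    ((hs.inter_right ht).image_of_continuousOn (hg.mono Set.inter_subset_left)).isClosed, ?_⟩
  ext u
  constructor
  · rintro ⟨hu, x, hx, rfl⟩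
    rw [Set.mem_preimage, hk hx] at hu
    exact ⟨⟨x, ⟨hx, hu⟩, rfl⟩, x, hx, rfl⟩
  · rintro ⟨⟨x, ⟨hx, hxt⟩, rfl⟩, hu⟩
    exact ⟨by rwa [Set.mem_preimage, hk hx], hu⟩


/-- existence (and uniqueness) of the isomorphic mean of a
continuous function `f` on `[a,b]` generated by `g, h`. -/
theorem stmt_4 {a b : ℝ} (hab : a < b) {f g h ginv : ℝ → ℝ}
    (hf : ContinuousOn f (Set.Icc a b))
    (hg : ContinuousOn g (Set.Icc a b))
    (hg_mono : StrictMonoOn g (Set.Icc a b) ∨ StrictAntiOn g (Set.Icc a b))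
    (hginv : ∀ t ∈ Set.Icc a b, ginv (g t) = t)
    (hh : ContinuousOn h
      (Set.Icc (sInf (f '' Set.Icc a b)) (sSup (f '' Set.Icc a b))))
    (hh_mono :
      StrictMonoOn h (Set.Icc (sInf (f '' Set.Icc a b)) (sSup (f '' Set.Icc a b))) ∨
      StrictAntiOn h (Set.Icc (sInf (f '' Set.Icc a b)) (sSup (f '' Set.Icc a b)))) :
    ∃! y : ℝ,
      y ∈ Set.Icc (sInf (f '' Set.Icc a b)) (sSup (f '' Set.Icc a b)) ∧
      h y = (g b - g a)⁻¹ * ∫ u in (g a)..(g b), h (f (ginv u)) := by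
  have ha : a ∈ Set.Icc a b := Set.left_mem_Icc.2 hab.le
  have hb : b ∈ Set.Icc a b := Set.right_mem_Icc.2 hab.le
  have hne : g a ≠ g b := fun h_eq => hab.ne (by rw [← hginv a ha, h_eq, hginv b hb])
  have hsub : Set.uIcc (g a) (g b) ⊆ g '' Set.Icc a b := by
    have := intermediate_value_uIcc (a := a) (b := b) (f := g) (by rwa [Set.uIcc_of_le hab.le])
    rwa [Set.uIcc_of_le hab.le] at this
  have hmem : ∀ t ∈ Set.Icc a b,
      f t ∈ Set.Icc (sInf (f '' Set.Icc a b)) (sSup (f '' Set.Icc a b)) := by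
    have hc := isCompact_Icc.image_of_continuousOn hf
    exact fun t ht => ⟨csInf_le hc.bddBelow ⟨t, ht, rfl⟩, le_csSup hc.bddAbove ⟨t, ht, rfl⟩⟩
  have hmaps : Set.MapsTo ginv (Set.uIcc (g a) (g b)) (Set.Icc a b) := by
    intro u hu
    obtain ⟨t, ht, rfl⟩ := hsub hu
    rwa [hginv t ht]
  have hcont : ContinuousOn (fun u => h (f (ginv u))) (Set.uIcc (g a) (g b)) :=
    hh.comp (hf.comp ((isCompact_Icc.continuousOn_leftInvOn hg hginv).mono hsub) hmaps)
      fun u hu => hmem _ (hmaps hu)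
  obtain ⟨c, hc, hceq⟩ := exists_eq_interval_average hne hcont
  have hcm := hmem _ (hmaps (Set.uIoo_subset_uIcc_self hc))
  have hinj : Set.InjOn h
      (Set.Icc (sInf (f '' Set.Icc a b)) (sSup (f '' Set.Icc a b))) :=
    hh_mono.elim StrictMonoOn.injOn StrictAntiOn.injOn
  rw [interval_average_eq, smul_eq_mul] at hceq
  exact ⟨f (ginv c), ⟨hcm, hceq⟩, fun y hy => hinj hy.1 hcm (hy.2.trans hceq.symm)⟩
end

section
/- Let f, m : [a,b] → ℝ be bounded functions and D₂ ⊆ [a,b] a subinterval such that m(x) ≥ f(x) for all x ∈ D₂ and m(x) = f(x) for all x ∈ [a,b] \ D₂. Let g be continuous and strictly monotone on [a,b] with inverse g⁻¹, and let h be continuous and strictly monotone on an interval containing the ranges of both f and m, and suppose both isomorphic means M_m|_{g,h} and M_f|_{g,h} exist (the corresponding averaged integrals exist and lie in the image of h). Then M_m|_{g,h} ≥ M_f|_{g,h}. Moreover, if m(x) > f(x) for all x ∈ D₂ and D₂ is a nondegenerate interval, then M_m|_{g,h} > M_f|_{g,h}. -/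
open Set MeasureTheory

/-- Monotonicity of the average of a function over an unordered interval. -/
theorem interval_average_mono {A B : ℝ} {F G : ℝ → ℝ}
    (hF : IntervalIntegrable F volume A B) (hG : IntervalIntegrable G volume A B)
    (hle : ∀ x ∈ uIcc A B, F x ≤ G x) :
    (B - A)⁻¹ * ∫ x in A..B, F x ≤ (B - A)⁻¹ * ∫ x in A..B, G x := by
  wlog hAB : A ≤ B generalizing A B
  · have := this hF.symm hG.symm (by rwa [uIcc_comm]) (le_of_not_ge hAB)
    rw [intervalIntegral.integral_symm A B, intervalIntegral.integral_symm A B,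
      ← neg_sub B A, inv_neg, neg_mul_neg, neg_mul_neg] at this
    exact this
  rw [uIcc_of_le hAB] at hle
  exact mul_le_mul_of_nonneg_left (intervalIntegral.integral_mono_on hAB hF hG hle)
    (inv_nonneg.2 (sub_nonneg.2 hAB))

/-- Strict monotonicity of the average of a function over an unordered interval, when the
inequality is strict on a nondegenerate subinterval. -/
theorem interval_average_strict_mono {A B p q : ℝ} {F G : ℝ → ℝ}
    (hF : IntervalIntegrable F volume A B) (hG : IntervalIntegrable G volume A B)
    (hle : ∀ x ∈ uIcc A B, F x ≤ G x) (hpq : p ≠ q) (hsub : uIcc p q ⊆ uIcc A B)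
    (hlt : ∀ x ∈ uIcc p q, F x < G x) :
    (B - A)⁻¹ * ∫ x in A..B, F x < (B - A)⁻¹ * ∫ x in A..B, G x := by
  wlog hpq' : p < q generalizing p q
  · exact this hpq.symm (by rwa [uIcc_comm]) (by rwa [uIcc_comm])
      (lt_of_le_of_ne (not_lt.1 hpq') hpq.symm)
  wlog hAB : A ≤ B generalizing A B
  · have := this hF.symm hG.symm (by rwa [uIcc_comm]) (by rwa [uIcc_comm B A])
      (le_of_not_ge hAB)
    rw [intervalIntegral.integral_symm A B, intervalIntegral.integral_symm A B,
      ← neg_sub B A, inv_neg, neg_mul_neg, neg_mul_neg] at this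
    exact this
  rw [uIcc_of_le hAB] at hle hsub
  rw [uIcc_of_le hpq'.le] at hsub hlt
  have hp := hsub (left_mem_Icc.2 hpq'.le)
  have hq := hsub (right_mem_Icc.2 hpq'.le)
  have hAB' : A < B := hp.1.trans_lt (hpq'.trans_le hq.2)
  refine mul_lt_mul_of_pos_left ?_ (inv_pos.2 (sub_pos.2 hAB'))
  refine intervalIntegral.integral_lt_integral_of_ae_le_of_measure_setOfPred_lt_ne_zero hAB hF hG
    ((ae_restrict_mem measurableSet_Ioc).mono fun x hx => hle x (Ioc_subset_Icc_self hx)) ?_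
  have hpos : 0 < (volume.restrict (Ioc A B)) (Ioc p q) := by
    rw [Measure.restrict_apply measurableSet_Ioc,
      inter_eq_left.2 (Ioc_subset_Ioc hp.1 hq.2), Real.volume_Ioc]
    simpa using hpq'
  exact (hpos.trans_le (measure_mono fun x hx => hlt x (Ioc_subset_Icc_self hx))).ne'

/-- A strictly monotone or antitone function maps an interval into the unordered interval
between the images of its endpoints. -/
theorem mem_uIcc_of_strictMonoOn_or_strictAntiOn {a b t : ℝ} {g : ℝ → ℝ}
    (hg : StrictMonoOn g (Icc a b) ∨ StrictAntiOn g (Icc a b)) (ht : t ∈ Icc a b) :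
    g t ∈ uIcc (g a) (g b) := by
  have hab := ht.1.trans ht.2
  have ha := left_mem_Icc.2 hab
  have hb := right_mem_Icc.2 hab
  rcases hg with hg | hg
  · exact Icc_subset_uIcc ⟨hg.monotoneOn ha ht ht.1, hg.monotoneOn ht hb ht.2⟩
  · exact Icc_subset_uIcc' ⟨hg.antitoneOn ht hb ht.2, hg.antitoneOn ha ht ht.1⟩

/-- monotonicity property of the isomorphic mean: if `m ≥ f` on a
subinterval `D₂` of `[a,b]` and `m = f` elsewhere, then `M_m|_{g,h} ≥ M_f|_{g,h}`;
if moreover `m > f` on a nondegenerate `D₂`, the inequality is strict. -/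
theorem stmt_6 {a b : ℝ} (hab : a < b) {f m g h ginv : ℝ → ℝ}
    (hf_bdd : BddAbove (f '' Set.Icc a b) ∧ BddBelow (f '' Set.Icc a b))
    (hm_bdd : BddAbove (m '' Set.Icc a b) ∧ BddBelow (m '' Set.Icc a b))
    {D₂ : Set ℝ} (hD₂sub : D₂ ⊆ Set.Icc a b) (hD₂conn : D₂.OrdConnected)
    (hge : ∀ x ∈ D₂, f x ≤ m x)
    (heq : ∀ x ∈ Set.Icc a b, x ∉ D₂ → m x = f x)
    (hg : ContinuousOn g (Set.Icc a b))
    (hg_mono : StrictMonoOn g (Set.Icc a b) ∨ StrictAntiOn g (Set.Icc a b))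
    (hginv : ∀ t ∈ Set.Icc a b, ginv (g t) = t)
    {I : Set ℝ} (hI : I.OrdConnected)
    (hfI : f '' Set.Icc a b ⊆ I) (hmI : m '' Set.Icc a b ⊆ I)
    (hh : ContinuousOn h I)
    (hh_mono : StrictMonoOn h I ∨ StrictAntiOn h I)
    (hfint : IntervalIntegrable (fun u => h (f (ginv u)))
      MeasureTheory.volume (g a) (g b))
    (hmint : IntervalIntegrable (fun u => h (m (ginv u)))
      MeasureTheory.volume (g a) (g b))
    {yf ym : ℝ} (hyfI : yf ∈ I) (hymI : ym ∈ I)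
    (hyf : h yf = (g b - g a)⁻¹ * ∫ u in (g a)..(g b), h (f (ginv u)))
    (hym : h ym = (g b - g a)⁻¹ * ∫ u in (g a)..(g b), h (m (ginv u))) :
    yf ≤ ym ∧
    ((∀ x ∈ D₂, f x < m x) → (∃ u ∈ D₂, ∃ v ∈ D₂, u < v) → yf < ym) := by
  have hsurj : ∀ {s t : ℝ}, s ≤ t → Set.Icc s t ⊆ Set.Icc a b →
      ∀ w ∈ Set.uIcc (g s) (g t), ∃ x ∈ Set.Icc s t, g x = w := by
    intro s t hst hsub w hw
    have h1 : ContinuousOn g (Set.uIcc s t) := by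
      rw [Set.uIcc_of_le hst]; exact hg.mono hsub
    have h2 := intermediate_value_uIcc h1 hw
    rwa [Set.uIcc_of_le hst] at h2
  have hfm : ∀ x ∈ Set.Icc a b, f x ≤ m x := fun x hx => by
    by_cases hxD : x ∈ D₂
    · exact hge x hxD
    · exact (heq x hx hxD).ge
  have hginj : Set.InjOn g (Set.Icc a b) := hg_mono.elim (·.injOn) (·.injOn)
  have hmemf : ∀ x ∈ Set.Icc a b, f x ∈ I := fun x hx => hfI ⟨x, hx, rfl⟩
  have hmemm : ∀ x ∈ Set.Icc a b, m x ∈ I := fun x hx => hmI ⟨x, hx, rfl⟩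
  have hsubD : ∀ {u v : ℝ}, u ∈ D₂ → v ∈ D₂ → u < v → g u ≠ g v ∧
      Set.uIcc (g u) (g v) ⊆ Set.uIcc (g a) (g b) ∧
      ∀ w ∈ Set.uIcc (g u) (g v), ∃ x ∈ D₂, g x = w := by
    intro u v hu hv huv
    refine ⟨fun h => huv.ne (hginj (hD₂sub hu) (hD₂sub hv) h), Set.uIcc_subset_uIcc
      (mem_uIcc_of_strictMonoOn_or_strictAntiOn hg_mono (hD₂sub hu))
      (mem_uIcc_of_strictMonoOn_or_strictAntiOn hg_mono (hD₂sub hv)), fun w hw => ?_⟩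
    obtain ⟨x, hx, rfl⟩ := hsurj huv.le ((hD₂conn.out hu hv).trans hD₂sub) w hw
    exact ⟨x, hD₂conn.out hu hv hx, rfl⟩
  rcases hh_mono with hmono | hanti
  · have hle : ∀ w ∈ Set.uIcc (g a) (g b), h (f (ginv w)) ≤ h (m (ginv w)) := by
      intro w hw
      obtain ⟨x, hx, rfl⟩ := hsurj hab.le subset_rfl w hw
      rw [hginv x hx]
      exact hmono.monotoneOn (hmemf x hx) (hmemm x hx) (hfm x hx)
    refine ⟨(hmono.le_iff_le hyfI hymI).1 ?_, fun hlt ⟨u, hu, v, hv, huv⟩ =>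
      (hmono.lt_iff_lt hyfI hymI).1 ?_⟩
    · rw [hyf, hym]
      exact interval_average_mono hfint hmint hle
    · obtain ⟨hne, hsub, hD⟩ := hsubD hu hv huv
      rw [hyf, hym]
      refine interval_average_strict_mono hfint hmint hle hne hsub fun w hw => ?_
      obtain ⟨x, hx, rfl⟩ := hD w hw
      rw [hginv x (hD₂sub hx)]
      exact hmono (hmemf x (hD₂sub hx)) (hmemm x (hD₂sub hx)) (hlt x hx)
  · have hle : ∀ w ∈ Set.uIcc (g a) (g b), h (m (ginv w)) ≤ h (f (ginv w)) := by
      intro w hw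
      obtain ⟨x, hx, rfl⟩ := hsurj hab.le subset_rfl w hw
      rw [hginv x hx]
      exact hanti.antitoneOn (hmemf x hx) (hmemm x hx) (hfm x hx)
    refine ⟨(hanti.le_iff_ge hymI hyfI).1 ?_, fun hlt ⟨u, hu, v, hv, huv⟩ =>
      (hanti.lt_iff_gt hymI hyfI).1 ?_⟩
    · rw [hyf, hym]
      exact interval_average_mono hmint hfint hle
    · obtain ⟨hne, hsub, hD⟩ := hsubD hu hv huv
      rw [hyf, hym]
      refine interval_average_strict_mono hmint hfint hle hne hsub fun w hw => ?_
      obtain ⟨x, hx, rfl⟩ := hD w hw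
      rw [hginv x (hD₂sub hx)]
      exact hanti (hmemf x (hD₂sub hx)) (hmemm x (hD₂sub hx)) (hlt x hx)
end

section
/- Let f : [a,b] → M (M its range, a < b) be strictly monotone, differentiable and bounded; let g, G be twice continuously differentiable bijections on [a,b] with g'(x) ≠ 0 and G'(x) ≠ 0 on [a,b]; let h, H be twice continuously differentiable bijections on M with h' ≠ 0 and H' ≠ 0 on M. Set γ := h ∘ f and Γ := H ∘ f, and assume γ'(v) ≠ 0 and Γ'(v) ≠ 0 for v ∈ [a,b]. If f is increasing and for all u, v ∈ [a,b] one has ((γ(u) − γ(v))/γ'(v)) · (g'(u)/g'(v)) ≤ ((Γ(u) − Γ(v))/Γ'(v)) · (G'(u)/G'(v)), then M_f|_{g,h} ≤ M_f|_{G,H}. If f is decreasing and the reverse inequality ((γ(u) − γ(v))/γ'(v)) · (g'(u)/g'(v)) ≥ ((Γ(u) − Γ(v))/Γ'(v)) · (G'(u)/G'(v)) holds for all u, v ∈ [a,b], then again M_f|_{g,h} ≤ M_f|_{G,H}. -/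
/-- Dividing an injective continuous function by a nonzero value of its derivative makes it
strictly increasing. -/
theorem strictMonoOn_div_of_injOn_of_hasDerivWithinAt {a b v d : ℝ} (hab : a < b) {F : ℝ → ℝ}
    (hc : ContinuousOn F (Set.Icc a b)) (hF : Set.InjOn F (Set.Icc a b))
    (hv : v ∈ Set.Icc a b) (hd : HasDerivWithinAt F d (Set.Icc a b) v) (hd0 : d ≠ 0) :
    StrictMonoOn (fun w => F w / d) (Set.Icc a b) := by
  have hdw : derivWithin F (Set.Icc a b) v = d := hd.derivWithin (uniqueDiffOn_Icc hab v hv)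
  rcases hc.strictMonoOn_of_injOn_Icc' hab.le hF with hm | hm
  · have hpos : 0 < d := lt_of_le_of_ne (hdw ▸ hm.monotoneOn.derivWithin_nonneg) hd0.symm
    intro x hx y hy hxy
    exact div_lt_div_of_pos_right (hm hx hy hxy) hpos
  · have hneg : d < 0 := lt_of_le_of_ne (hdw ▸ hm.antitoneOn.derivWithin_nonpos) hd0
    intro x hx y hy hxy
    exact div_lt_div_of_neg_of_lt hneg (hm hx hy hxy)

theorem continuousOn_of_contDiffOn_of_hasDerivWithinAt {a b : ℝ} (hab : a < b) {g g' : ℝ → ℝ}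
    (hg2 : ContDiffOn ℝ 2 g (Set.Icc a b))
    (hg' : ∀ x ∈ Set.Icc a b, HasDerivWithinAt g (g' x) (Set.Icc a b) x) :
    ContinuousOn g' (Set.Icc a b) :=
  (hg2.continuousOn_derivWithin (uniqueDiffOn_Icc hab) (by norm_num)).congr fun x hx =>
    ((hg' x hx).derivWithin (uniqueDiffOn_Icc hab x hx)).symm

theorem integral_sub_const_mul_deriv {a b c : ℝ} (hab : a < b) {F g g' : ℝ → ℝ}
    (hF : ContinuousOn F (Set.Icc a b)) (hg'c : ContinuousOn g' (Set.Icc a b))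
    (hg' : ∀ x ∈ Set.Icc a b, HasDerivWithinAt g (g' x) (Set.Icc a b) x) :
    ∫ x in a..b, (F x - c) * g' x = (∫ x in a..b, F x * g' x) - c * (g b - g a) := by
  have hi : IntervalIntegrable g' MeasureTheory.volume a b :=
    hg'c.intervalIntegrable_of_Icc hab.le
  have hFi : IntervalIntegrable (fun x => F x * g' x) MeasureTheory.volume a b :=
    (hF.mul hg'c).intervalIntegrable_of_Icc hab.le
  have hint : ∫ x in a..b, g' x = g b - g a :=
    intervalIntegral.integral_eq_sub_of_hasDerivAt_of_le hab.le
      (fun x hx => (hg' x hx).continuousWithinAt)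
      (fun x hx => (hg' x (Set.Ioo_subset_Icc_self hx)).hasDerivAt (Icc_mem_nhds hx.1 hx.2)) hi
  simp_rw [sub_mul]
  rw [intervalIntegral.integral_sub hFi (hi.const_mul c), intervalIntegral.integral_const_mul, hint]

/-- The integral of the Losonczi-type kernel at `v`, in terms of the quasi-arithmetic mean `m`. -/
theorem integral_kernel_eq {a b m v c d : ℝ} (hab : a < b) {F g g' : ℝ → ℝ}
    (hF : ContinuousOn F (Set.Icc a b)) (hg'c : ContinuousOn g' (Set.Icc a b))
    (hg_inj : Set.InjOn g (Set.Icc a b))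
    (hg' : ∀ x ∈ Set.Icc a b, HasDerivWithinAt g (g' x) (Set.Icc a b) x)
    (hm : m = (g b - g a)⁻¹ * ∫ x in a..b, F x * g' x) :
    ∫ x in a..b, ((F x - F v) / c) * (g' x / d) = ((m - F v) / c) * ((g b - g a) / d) := by
  have hne : g b - g a ≠ 0 := fun h0 =>
    hab.ne' (hg_inj (Set.right_mem_Icc.2 hab.le) (Set.left_mem_Icc.2 hab.le) (sub_eq_zero.1 h0))
  have hI : ∫ x in a..b, F x * g' x = m * (g b - g a) := by
    rw [hm]; field_simp
  simp_rw [div_mul_div_comm]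
  rw [intervalIntegral.integral_div, integral_sub_const_mul_deriv hab hF hg'c hg', hI]
  ring

theorem intervalIntegrable_kernel {a b v c d : ℝ} (hab : a < b) {F g' : ℝ → ℝ}
    (hF : ContinuousOn F (Set.Icc a b)) (hg'c : ContinuousOn g' (Set.Icc a b)) :
    IntervalIntegrable (fun x => ((F x - F v) / c) * (g' x / d)) MeasureTheory.volume a b :=
  (((hF.sub continuousOn_const).div_const c).mul (hg'c.div_const d)).intervalIntegrable_of_Icc
    hab.le


/-- sufficient conditions (derived from Losonczi's theorem) for
the comparison `M_f|_{g,h} ≤ M_f|_{G,H}` of two isomorphic means, in terms of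
`γ := h ∘ f`, `Γ := H ∘ f` and the derivatives of the generator mappings. -/
theorem stmt_12 {a b : ℝ} (hab : a < b) {f g G h H f' g' G' γ' Γ' : ℝ → ℝ}
    (hf_mono : StrictMonoOn f (Set.Icc a b) ∨ StrictAntiOn f (Set.Icc a b))
    (hf' : ∀ x ∈ Set.Icc a b, HasDerivWithinAt f (f' x) (Set.Icc a b) x)
    (hf_bdd : BddAbove (f '' Set.Icc a b) ∧ BddBelow (f '' Set.Icc a b))
    (hg2 : ContDiffOn ℝ 2 g (Set.Icc a b)) (hG2 : ContDiffOn ℝ 2 G (Set.Icc a b))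
    (hg_inj : Set.InjOn g (Set.Icc a b)) (hG_inj : Set.InjOn G (Set.Icc a b))
    (hg' : ∀ x ∈ Set.Icc a b, HasDerivWithinAt g (g' x) (Set.Icc a b) x)
    (hG' : ∀ x ∈ Set.Icc a b, HasDerivWithinAt G (G' x) (Set.Icc a b) x)
    (hg'0 : ∀ x ∈ Set.Icc a b, g' x ≠ 0) (hG'0 : ∀ x ∈ Set.Icc a b, G' x ≠ 0)
    (hh2 : ContDiffOn ℝ 2 h (f '' Set.Icc a b))
    (hH2 : ContDiffOn ℝ 2 H (f '' Set.Icc a b))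
    (hh_inj : Set.InjOn h (f '' Set.Icc a b))
    (hH_inj : Set.InjOn H (f '' Set.Icc a b))
    (hγ' : ∀ x ∈ Set.Icc a b,
      HasDerivWithinAt (fun t => h (f t)) (γ' x) (Set.Icc a b) x)
    (hΓ' : ∀ x ∈ Set.Icc a b,
      HasDerivWithinAt (fun t => H (f t)) (Γ' x) (Set.Icc a b) x)
    (hγ'0 : ∀ x ∈ Set.Icc a b, γ' x ≠ 0) (hΓ'0 : ∀ x ∈ Set.Icc a b, Γ' x ≠ 0)
    {ygh yGH : ℝ}
    (hygh_mem : ygh ∈ Set.Icc (sInf (f '' Set.Icc a b)) (sSup (f '' Set.Icc a b)))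
    (hyGH_mem : yGH ∈ Set.Icc (sInf (f '' Set.Icc a b)) (sSup (f '' Set.Icc a b)))
    (hygh : h ygh = (g b - g a)⁻¹ * ∫ x in a..b, h (f x) * g' x)
    (hyGH : H yGH = (G b - G a)⁻¹ * ∫ x in a..b, H (f x) * G' x) :
    (StrictMonoOn f (Set.Icc a b) →
      (∀ u ∈ Set.Icc a b, ∀ v ∈ Set.Icc a b,
        ((h (f u) - h (f v)) / γ' v) * (g' u / g' v) ≤
          ((H (f u) - H (f v)) / Γ' v) * (G' u / G' v)) →
      ygh ≤ yGH) ∧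
    (StrictAntiOn f (Set.Icc a b) →
      (∀ u ∈ Set.Icc a b, ∀ v ∈ Set.Icc a b,
        ((H (f u) - H (f v)) / Γ' v) * (G' u / G' v) ≤
          ((h (f u) - h (f v)) / γ' v) * (g' u / g' v)) →
      ygh ≤ yGH) := by
  have hfc : ContinuousOn f (Set.Icc a b) := fun x hx => (hf' x hx).continuousWithinAt
  have hf_inj : Set.InjOn f (Set.Icc a b) := hf_mono.elim (·.injOn) (·.injOn)
  have himg : f '' Set.Icc a b =
      Set.Icc (sInf (f '' Set.Icc a b)) (sSup (f '' Set.Icc a b)) := hfc.image_Icc hab.le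
  rw [← himg] at hygh_mem hyGH_mem
  obtain ⟨v, hv, rfl⟩ := hygh_mem
  obtain ⟨w, hw, rfl⟩ := hyGH_mem
  have hγc : ContinuousOn (fun t => h (f t)) (Set.Icc a b) :=
    fun x hx => (hγ' x hx).continuousWithinAt
  have hΓc : ContinuousOn (fun t => H (f t)) (Set.Icc a b) :=
    fun x hx => (hΓ' x hx).continuousWithinAt
  have hg'c := continuousOn_of_contDiffOn_of_hasDerivWithinAt hab hg2 hg'
  have hG'c := continuousOn_of_contDiffOn_of_hasDerivWithinAt hab hG2 hG'
  have hIg := integral_kernel_eq (v := v) (c := γ' v) (d := g' v) hab hγc hg'c hg_inj hg' hygh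
  have hIG := integral_kernel_eq (v := v) (c := Γ' v) (d := G' v) hab hΓc hG'c hG_inj hG' hyGH
  have hig := intervalIntegrable_kernel (v := v) (c := γ' v) (d := g' v) hab hγc hg'c
  have hiG := intervalIntegrable_kernel (v := v) (c := Γ' v) (d := G' v) hab hΓc hG'c
  rw [sub_self, zero_div, zero_mul] at hIg
  have hΓm : StrictMonoOn (fun t => H (f t) / Γ' v) (Set.Icc a b) :=
    strictMonoOn_div_of_injOn_of_hasDerivWithinAt hab hΓc
      (hH_inj.comp hf_inj (Set.mapsTo_image f _)) hv (hΓ' v hv) (hΓ'0 v hv)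
  have hGpos : 0 < (G b - G a) / G' v := by
    rw [sub_div, sub_pos]
    exact strictMonoOn_div_of_injOn_of_hasDerivWithinAt hab hG2.continuousOn hG_inj hv (hG' v hv)
      (hG'0 v hv) (Set.left_mem_Icc.2 hab.le) (Set.right_mem_Icc.2 hab.le) hab
  constructor
  · intro hm hle
    have hI := intervalIntegral.integral_mono_on hab.le hig hiG fun u hu => hle u hu v hv
    rw [hIg, hIG] at hI
    have hq := nonneg_of_mul_nonneg_left hI hGpos
    rw [sub_div, sub_nonneg] at hq
    exact hm.monotoneOn hv hw ((hΓm.le_iff_le hv hw).1 hq)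
  · intro hm hle
    have hI := intervalIntegral.integral_mono_on hab.le hiG hig fun u hu => hle u hu v hv
    rw [hIg, hIG] at hI
    have hq := nonpos_of_mul_nonpos_left hI hGpos
    rw [sub_div, sub_nonpos] at hq
    exact hm.antitoneOn hw hv ((hΓm.le_iff_le hw hv).1 hq)
end

section
/- Let f : D → M be defined on an interval D = [a,b] (a < b) with range M contained in an interval I, and let g, h be continuous strictly monotone functions on I such that the class I isomorphic means M_f|_g = g⁻¹((1/(b−a)) ∫_a^b g(f(x)) dx) and M_f|_h = h⁻¹((1/(b−a)) ∫_a^b h(f(x)) dx) exist. Then: (1) if g is increasing on I and g ∘ h⁻¹ is convex on h(I), then M_f|_g ≥ M_f|_h; (2) if g is increasing on I and g ∘ h⁻¹ is concave on h(I), then M_f|_g ≤ M_f|_h; (3) if g is decreasing on I and g ∘ h⁻¹ is convex on h(I), then M_f|_g ≤ M_f|_h; (4) if g is decreasing on I and g ∘ h⁻¹ is concave on h(I), then M_f|_g ≥ M_f|_h. Moreover, if g, h are differentiable on I with h' ≠ 0: (5) if |g'/h'| is increasing on I then M_f|_g ≥ M_f|_h; (6) if |g'/h'| is decreasing on I then M_f|_g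 ≤ M_f|_h. -/
open MeasureTheory Set Filter

/-- A convex function on a subset of `ℝ` has a supporting line at each interior point. -/
theorem ConvexOn.exists_supporting_line {S : Set ℝ} {φ : ℝ → ℝ} (hφ : ConvexOn ℝ S φ) {c : ℝ}
    (hc : c ∈ interior S) : ∃ K, ∀ s ∈ S, φ c + K * (s - c) ≤ φ s := by
  refine ⟨derivWithin φ (Ioi c) c, fun s hs => ?_⟩
  rcases lt_trichotomy c s with h | rfl | h
  · have := hφ.rightDeriv_le_slope_of_mem_interior hc hs h
    rw [slope_def_field, le_div_iff₀ (by linarith)] at this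
    linarith
  · simp
  · have := (hφ.slope_le_leftDeriv_of_mem_interior hs hc h).trans
      (hφ.leftDeriv_le_rightDeriv_of_mem_interior hc)
    rw [slope_def_field, div_le_iff₀ (by linarith)] at this
    linarith

theorem le_average_of_affine_le {a b : ℝ} (hab : a < b) {u v : ℝ → ℝ} {c d K : ℝ}
    (hu : IntervalIntegrable u volume a b) (hv : IntervalIntegrable v volume a b)
    (hc : c = (b - a)⁻¹ * ∫ x in a..b, u x)
    (hle : ∀ x ∈ Icc a b, d + K * (u x - c) ≤ v x) :
    d ≤ (b - a)⁻¹ * ∫ x in a..b, v x := by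
  have hba : 0 < b - a := sub_pos.2 hab
  have hsub : IntervalIntegrable (fun x => u x - c) volume a b :=
    hu.sub intervalIntegrable_const
  have hint := intervalIntegral.integral_mono_on hab.le
    (intervalIntegrable_const.add (hsub.const_mul K)) hv hle
  rw [intervalIntegral.integral_add intervalIntegrable_const (hsub.const_mul K),
    intervalIntegral.integral_const_mul, intervalIntegral.integral_sub hu intervalIntegrable_const,
    intervalIntegral.integral_const, intervalIntegral.integral_const] at hint
  have hu' : ∫ x in a..b, u x = (b - a) * c := by rw [hc]; field_simp
  rw [hu', smul_eq_mul, smul_eq_mul, sub_self, mul_zero, add_zero] at hint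
  rwa [inv_mul_eq_div, le_div_iff₀ hba, mul_comm]

/-- A function bounded below by its average is almost everywhere equal to it. -/
theorem ae_eq_average_of_average_le {a b : ℝ} (hab : a < b) {u : ℝ → ℝ} {c : ℝ}
    (hu : IntervalIntegrable u volume a b) (hc : c = (b - a)⁻¹ * ∫ x in a..b, u x)
    (hle : ∀ x ∈ Icc a b, c ≤ u x) : ∀ᵐ x ∂volume.restrict (Ioc a b), u x = c := by
  have hba : 0 < b - a := sub_pos.2 hab
  have hzero : ∫ x in a..b, (u x - c) = 0 := by
    rw [intervalIntegral.integral_sub hu intervalIntegrable_const,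
      intervalIntegral.integral_const, hc, smul_eq_mul]
    field_simp
    ring
  have hnonneg : 0 ≤ᵐ[volume.restrict (Ioc a b)] fun x => u x - c :=
    (ae_restrict_iff' measurableSet_Ioc).2 <|
      .of_forall fun x hx => sub_nonneg.2 (hle x (Ioc_subset_Icc_self hx))
  filter_upwards [(intervalIntegral.integral_eq_zero_iff_of_le_of_nonneg_ae hab.le hnonneg
    (hu.sub intervalIntegrable_const)).1 hzero] with x hx
  exact sub_eq_zero.1 hx

/-- Jensen's inequality on an interval, without closedness of the domain or continuity of the
convex function. -/
theorem ConvexOn.map_interval_average_le {a b : ℝ} (hab : a < b) {S : Set ℝ} {φ u : ℝ → ℝ} {c : ℝ}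
    (hφ : ConvexOn ℝ S φ) (huS : ∀ x ∈ Icc a b, u x ∈ S)
    (hu : IntervalIntegrable u volume a b)
    (hφu : IntervalIntegrable (fun x => φ (u x)) volume a b)
    (hc : c = (b - a)⁻¹ * ∫ x in a..b, u x) :
    φ c ≤ (b - a)⁻¹ * ∫ x in a..b, φ (u x) := by
  have hba : 0 < b - a := sub_pos.2 hab
  have of_ae (h : ∀ᵐ x ∂volume.restrict (Ioc a b), u x = c) :
      φ c ≤ (b - a)⁻¹ * ∫ x in a..b, φ (u x) := by
    have : ∫ x in a..b, φ (u x) = ∫ _ in a..b, φ c := by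
      simp_rw [intervalIntegral.integral_of_le hab.le]
      exact integral_congr_ae (h.mono fun x hx => by simp [hx])
    rw [this, intervalIntegral.integral_const, smul_eq_mul, inv_mul_cancel_left₀ hba.ne']
  by_cases hlow : ∀ x ∈ Icc a b, c ≤ u x
  · exact of_ae (ae_eq_average_of_average_le hab hu hc hlow)
  by_cases hup : ∀ x ∈ Icc a b, u x ≤ c
  · refine of_ae ((ae_eq_average_of_average_le hab hu.neg (c := -c) ?_ ?_).mono fun x hx => ?_)
    · simp [hc]
    · simpa using hup
    · simpa using hx
  push Not at hlow hup
  obtain ⟨x, hx, hxc⟩ := hlow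
  obtain ⟨y, hy, hyc⟩ := hup
  have hcS : c ∈ interior S :=
    interior_mono (hφ.1.ordConnected.out (huS x hx) (huS y hy)) (by simp [hxc, hyc])
  obtain ⟨K, hK⟩ := hφ.exists_supporting_line hcS
  exact le_average_of_affine_le hab hu hφu hc fun t ht => hK _ (huS t ht)

/-- First derivative test for a global minimum on an interval. -/
theorem le_of_hasDerivAt_nonpos_left_nonneg_right {I : Set ℝ} (hI : I.OrdConnected)
    {F F' : ℝ → ℝ} {y t : ℝ} (hy : y ∈ I) (ht : t ∈ I) (hF : ContinuousOn F I)
    (hF' : ∀ s ∈ interior I, HasDerivAt F (F' s) s)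
    (hleft : ∀ s ∈ interior I, s < y → F' s ≤ 0)
    (hright : ∀ s ∈ interior I, y < s → 0 ≤ F' s) : F y ≤ F t := by
  rcases le_total y t with h | h
  · have hsub := hI.out hy ht
    have hmono : MonotoneOn F (Icc y t) :=
      monotoneOn_of_hasDerivWithinAt_nonneg (convex_Icc _ _) (hF.mono hsub)
        (fun s hs => (hF' s (interior_mono hsub hs)).hasDerivWithinAt)
        fun s hs => hright s (interior_mono hsub hs) (by rw [interior_Icc] at hs; exact hs.1)
    exact hmono (left_mem_Icc.2 h) (right_mem_Icc.2 h) h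
  · have hsub := hI.out ht hy
    have hanti : AntitoneOn F (Icc t y) :=
      antitoneOn_of_hasDerivWithinAt_nonpos (convex_Icc _ _) (hF.mono hsub)
        (fun s hs => (hF' s (interior_mono hsub hs)).hasDerivWithinAt)
        fun s hs => hleft s (interior_mono hsub hs) (by rw [interior_Icc] at hs; exact hs.2)
    exact hanti (left_mem_Icc.2 h) (right_mem_Icc.2 h) h

/-- A monotone function has nonnegative derivative at interior points. -/
theorem MonotoneOn.nonneg_of_hasDerivAt {I : Set ℝ} {g : ℝ → ℝ} {d s : ℝ} (hg : MonotoneOn g I)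
    (hs : s ∈ interior I) (hd : HasDerivAt g d s) : 0 ≤ d := by
  have hu : UniqueDiffWithinAt ℝ I s :=
    uniqueDiffWithinAt_of_mem_nhds (mem_interior_iff_mem_nhds.1 hs)
  rw [← hd.hasDerivWithinAt.derivWithin hu]
  exact hg.derivWithin_nonneg

theorem deriv_eq_abs_div_mul_of_monotoneOn {I : Set ℝ} {g h g' h' : ℝ → ℝ}
    (hg : MonotoneOn g I) (hh : MonotoneOn h I)
    (hg' : ∀ t ∈ I, HasDerivWithinAt g (g' t) I t) (hh' : ∀ t ∈ I, HasDerivWithinAt h (h' t) I t)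
    (hne : ∀ t ∈ I, h' t ≠ 0) {s : ℝ} (hs : s ∈ interior I) :
    0 < h' s ∧ g' s = |g' s / h' s| * h' s := by
  have hsI := interior_subset hs
  have hnhds := mem_interior_iff_mem_nhds.1 hs
  have h1 := hg.nonneg_of_hasDerivAt hs ((hg' s hsI).hasDerivAt hnhds)
  have h2 := (hh.nonneg_of_hasDerivAt hs ((hh' s hsI).hasDerivAt hnhds)).lt_of_ne' (hne s hsI)
  refine ⟨h2, ?_⟩
  rw [abs_of_nonneg (div_nonneg h1 h2.le), div_mul_cancel₀ _ h2.ne']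

theorem mul_sub_le_sub_of_monotoneOn_abs_deriv_div {I : Set ℝ} (hI : I.OrdConnected)
    {g h g' h' : ℝ → ℝ} (hg : MonotoneOn g I) (hh : MonotoneOn h I)
    (hg' : ∀ t ∈ I, HasDerivWithinAt g (g' t) I t) (hh' : ∀ t ∈ I, HasDerivWithinAt h (h' t) I t)
    (hne : ∀ t ∈ I, h' t ≠ 0) (hmono : MonotoneOn (fun t => |g' t / h' t|) I) {y t : ℝ}
    (hy : y ∈ I) (ht : t ∈ I) : |g' y / h' y| * (h t - h y) ≤ g t - g y := by
  have key := le_of_hasDerivAt_nonpos_left_nonneg_right hI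
    (F := fun s => g s - |g' y / h' y| * h s) (F' := fun s => g' s - |g' y / h' y| * h' s) hy ht
    (fun s hs => ((hg' s hs).sub ((hh' s hs).const_mul _)).continuousWithinAt)
    (fun s hs => ((hg' s (interior_subset hs)).sub
      ((hh' s (interior_subset hs)).const_mul _)).hasDerivAt (mem_interior_iff_mem_nhds.1 hs))
    (fun s hs hsy => by
      obtain ⟨hpos, heq⟩ := deriv_eq_abs_div_mul_of_monotoneOn hg hh hg' hh' hne hs
      have := mul_le_mul_of_nonneg_right (hmono (interior_subset hs) hy hsy.le) hpos.le
      dsimp only at this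
      linarith)
    (fun s hs hys => by
      obtain ⟨hpos, heq⟩ := deriv_eq_abs_div_mul_of_monotoneOn hg hh hg' hh' hne hs
      have := mul_le_mul_of_nonneg_right (hmono hy (interior_subset hs) hys.le) hpos.le
      dsimp only at this
      linarith)
  linarith

theorem sub_le_mul_sub_of_antitoneOn_abs_deriv_div {I : Set ℝ} (hI : I.OrdConnected)
    {g h g' h' : ℝ → ℝ} (hg : MonotoneOn g I) (hh : MonotoneOn h I)
    (hg' : ∀ t ∈ I, HasDerivWithinAt g (g' t) I t) (hh' : ∀ t ∈ I, HasDerivWithinAt h (h' t) I t)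
    (hne : ∀ t ∈ I, h' t ≠ 0) (hanti : AntitoneOn (fun t => |g' t / h' t|) I) {y t : ℝ}
    (hy : y ∈ I) (ht : t ∈ I) : g t - g y ≤ |g' y / h' y| * (h t - h y) := by
  have key := le_of_hasDerivAt_nonpos_left_nonneg_right hI
    (F := fun s => |g' y / h' y| * h s - g s) (F' := fun s => |g' y / h' y| * h' s - g' s) hy ht
    (fun s hs => (((hh' s hs).const_mul _).sub (hg' s hs)).continuousWithinAt)
    (fun s hs => (((hh' s (interior_subset hs)).const_mul _).sub
      (hg' s (interior_subset hs))).hasDerivAt (mem_interior_iff_mem_nhds.1 hs))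
    (fun s hs hsy => by
      obtain ⟨hpos, heq⟩ := deriv_eq_abs_div_mul_of_monotoneOn hg hh hg' hh' hne hs
      have := mul_le_mul_of_nonneg_right (hanti (interior_subset hs) hy hsy.le) hpos.le
      dsimp only at this
      linarith)
    (fun s hs hys => by
      obtain ⟨hpos, heq⟩ := deriv_eq_abs_div_mul_of_monotoneOn hg hh hg' hh' hne hs
      have := mul_le_mul_of_nonneg_right (hanti hy (interior_subset hs) hys.le) hpos.le
      dsimp only at this
      linarith)
  linarith

/-- Among increasing generators, the isomorphic means are ordered according to the monotonicity of
the ratio of the derivatives. -/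
theorem isomorphicMean_le_and_ge_of_abs_deriv_div {a b : ℝ} (hab : a < b) {f g h g' h' : ℝ → ℝ}
    {I : Set ℝ} (hI : I.OrdConnected) (hfI : ∀ x ∈ Icc a b, f x ∈ I)
    (hg : StrictMonoOn g I) (hh : StrictMonoOn h I)
    (hgint : IntervalIntegrable (fun x => g (f x)) volume a b)
    (hhint : IntervalIntegrable (fun x => h (f x)) volume a b)
    {yg yh : ℝ} (hygI : yg ∈ I) (hyhI : yh ∈ I)
    (hyg : g yg = (b - a)⁻¹ * ∫ x in a..b, g (f x))
    (hyh : h yh = (b - a)⁻¹ * ∫ x in a..b, h (f x))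
    (hg' : ∀ t ∈ I, HasDerivWithinAt g (g' t) I t) (hh' : ∀ t ∈ I, HasDerivWithinAt h (h' t) I t)
    (hne : ∀ t ∈ I, h' t ≠ 0) :
    (MonotoneOn (fun t => |g' t / h' t|) I → yh ≤ yg) ∧
      (AntitoneOn (fun t => |g' t / h' t|) I → yg ≤ yh) := by
  refine ⟨fun hmono => (hg.le_iff_le hyhI hygI).1 ?_, fun hanti => (hg.le_iff_le hygI hyhI).1 ?_⟩
  · rw [hyg]
    refine le_average_of_affine_le hab hhint hgint hyh (K := |g' yh / h' yh|) fun x hx => ?_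
    linarith [mul_sub_le_sub_of_monotoneOn_abs_deriv_div hI hg.monotoneOn hh.monotoneOn hg' hh' hne
      hmono hyhI (hfI x hx)]
  · have := le_average_of_affine_le hab (d := -g yh) hhint hgint.neg hyh
      (K := -|g' yh / h' yh|) fun x hx => by
        have := sub_le_mul_sub_of_antitoneOn_abs_deriv_div hI hg.monotoneOn hh.monotoneOn hg' hh'
          hne hanti hyhI (hfI x hx)
        simp only [Pi.neg_apply]
        linarith
    simp only [Pi.neg_apply, intervalIntegral.integral_neg, mul_neg] at this
    rw [hyg]
    linarith

/-- comparison of two class I isomorphic means of a function via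
convexity/concavity of `g ∘ h⁻¹` (here `φ`, with `φ (h t) = g t` on `I`), and
via the monotonicity of `|g'/h'|` when `g, h` are differentiable. -/
theorem stmt_13 {a b : ℝ} (hab : a < b) {f g h φ g' h' : ℝ → ℝ}
    {I : Set ℝ} (hI : I.OrdConnected) (hfI : f '' Set.Icc a b ⊆ I)
    (hg_cont : ContinuousOn g I) (hh_cont : ContinuousOn h I)
    (hg_mono : StrictMonoOn g I ∨ StrictAntiOn g I)
    (hh_mono : StrictMonoOn h I ∨ StrictAntiOn h I)
    (hφ : ∀ t ∈ I, φ (h t) = g t)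
    (hgint : IntervalIntegrable (fun x => g (f x)) MeasureTheory.volume a b)
    (hhint : IntervalIntegrable (fun x => h (f x)) MeasureTheory.volume a b)
    {yg yh : ℝ} (hygI : yg ∈ I) (hyhI : yh ∈ I)
    (hyg : g yg = (b - a)⁻¹ * ∫ x in a..b, g (f x))
    (hyh : h yh = (b - a)⁻¹ * ∫ x in a..b, h (f x)) :
    (StrictMonoOn g I → ConvexOn ℝ (h '' I) φ → yh ≤ yg) ∧
    (StrictMonoOn g I → ConcaveOn ℝ (h '' I) φ → yg ≤ yh) ∧
    (StrictAntiOn g I → ConvexOn ℝ (h '' I) φ → yg ≤ yh) ∧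
    (StrictAntiOn g I → ConcaveOn ℝ (h '' I) φ → yh ≤ yg) ∧
    ((∀ t ∈ I, HasDerivWithinAt g (g' t) I t) →
      (∀ t ∈ I, HasDerivWithinAt h (h' t) I t) →
      (∀ t ∈ I, h' t ≠ 0) →
      MonotoneOn (fun t => |g' t / h' t|) I → yh ≤ yg) ∧
    ((∀ t ∈ I, HasDerivWithinAt g (g' t) I t) →
      (∀ t ∈ I, HasDerivWithinAt h (h' t) I t) →
      (∀ t ∈ I, h' t ≠ 0) →
      AntitoneOn (fun t => |g' t / h' t|) I → yg ≤ yh) := by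
  have hfI' : ∀ x ∈ Icc a b, f x ∈ I := fun x hx => hfI ⟨x, hx, rfl⟩
  have hfS : ∀ x ∈ Icc a b, h (f x) ∈ h '' I := fun x hx => mem_image_of_mem h (hfI' x hx)
  have hφint : IntervalIntegrable (fun x => φ (h (f x))) volume a b :=
    hgint.congr fun x hx => by
      rw [uIoc_of_le hab.le] at hx
      exact (hφ _ (hfI' x (Ioc_subset_Icc_self hx))).symm
  have hφavg : (b - a)⁻¹ * ∫ x in a..b, φ (h (f x)) = g yg := by
    rw [hyg, intervalIntegral.integral_congr fun x hx => ?_]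
    rw [uIcc_of_le hab.le] at hx
    exact hφ _ (hfI' x hx)
  have convex_le (hc : ConvexOn ℝ (h '' I) φ) : g yh ≤ g yg := by
    rw [← hφ yh hyhI, ← hφavg]
    exact hc.map_interval_average_le hab hfS hhint hφint hyh
  have concave_le (hc : ConcaveOn ℝ (h '' I) φ) : g yg ≤ g yh := by
    have := hc.neg.map_interval_average_le hab hfS hhint hφint.neg hyh
    simp only [Pi.neg_apply, intervalIntegral.integral_neg, mul_neg] at this
    rw [hφavg, hφ yh hyhI] at this
    linarith
  have deriv_case (hg' : ∀ t ∈ I, HasDerivWithinAt g (g' t) I t)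
      (hh' : ∀ t ∈ I, HasDerivWithinAt h (h' t) I t) (hne : ∀ t ∈ I, h' t ≠ 0) :
      (MonotoneOn (fun t => |g' t / h' t|) I → yh ≤ yg) ∧
        (AntitoneOn (fun t => |g' t / h' t|) I → yg ≤ yh) := by
    have hg'n : ∀ t ∈ I, HasDerivWithinAt (fun x => -g x) (-g' t) I t := fun t ht => (hg' t ht).neg
    have hh'n : ∀ t ∈ I, HasDerivWithinAt (fun x => -h x) (-h' t) I t := fun t ht => (hh' t ht).neg
    have hnen : ∀ t ∈ I, -h' t ≠ 0 := fun t ht => neg_ne_zero.2 (hne t ht)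
    have hygn : -g yg = (b - a)⁻¹ * ∫ x in a..b, -g (f x) := by simp [hyg]
    have hyhn : -h yh = (b - a)⁻¹ * ∫ x in a..b, -h (f x) := by simp [hyh]
    rcases hg_mono with hg | hg <;> rcases hh_mono with hh | hh
    · exact isomorphicMean_le_and_ge_of_abs_deriv_div hab hI hfI' hg hh hgint hhint hygI hyhI
        hyg hyh hg' hh' hne
    · simpa [div_neg] using isomorphicMean_le_and_ge_of_abs_deriv_div hab hI hfI' hg hh.neg hgint
        hhint.neg hygI hyhI hyg hyhn hg' hh'n hnen
    · simpa [neg_div] using isomorphicMean_le_and_ge_of_abs_deriv_div hab hI hfI' hg.neg hh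
        hgint.neg hhint hygI hyhI hygn hyh hg'n hh' hne
    · simpa using isomorphicMean_le_and_ge_of_abs_deriv_div hab hI hfI' hg.neg hh.neg
        hgint.neg hhint.neg hygI hyhI hygn hyhn hg'n hh'n hnen
  exact ⟨fun hg hc => (hg.le_iff_le hyhI hygI).1 (convex_le hc),
    fun hg hc => (hg.le_iff_le hygI hyhI).1 (concave_le hc),
    fun hg hc => (hg.le_iff_ge hyhI hygI).1 (convex_le hc),
    fun hg hc => (hg.le_iff_ge hygI hyhI).1 (concave_le hc),
    fun hg' hh' hne => (deriv_case hg' hh' hne).1,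
    fun hg' hh' hne => (deriv_case hg' hh' hne).2⟩
end

section
/- Let f be a positive, twice continuously differentiable, monotone function on [a,b] with 0 < a < b. If for all u, v ∈ [a,b] one has f(u)/f(v) − (u/v)·ln(f(u)/f(v)) − 1 ≥ 0, then the geometric mean of f on [a,b] is at most its elastic mean; that is, exp( (1/(b−a)) ∫_a^b ln f(x) dx ) ≤ (1/(ln b − ln a)) ∫_a^b (f(x)/x) dx. -/
/-- sufficient condition for the geometric mean of a positive
`C²` monotone function on `[a,b]` (0 < a < b) to be at most its elastic mean. -/
theorem stmt_16 {a b : ℝ} (ha : 0 < a) (hab : a < b) {f : ℝ → ℝ}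
    (hf_pos : ∀ x ∈ Set.Icc a b, 0 < f x)
    (hf_c2 : ContDiffOn ℝ 2 f (Set.Icc a b))
    (hf_mono : MonotoneOn f (Set.Icc a b) ∨ AntitoneOn f (Set.Icc a b))
    (hcond : ∀ u ∈ Set.Icc a b, ∀ v ∈ Set.Icc a b,
      0 ≤ f u / f v - (u / v) * Real.log (f u / f v) - 1) :
    Real.exp ((b - a)⁻¹ * ∫ x in a..b, Real.log (f x)) ≤
      (Real.log b - Real.log a)⁻¹ * ∫ x in a..b, f x / x := by
  have hle := hab.le
  have hf_cont := hf_c2.continuousOn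
  have hlog : ContinuousOn (fun x => Real.log (f x)) (Set.uIcc a b) := by
    rw [Set.uIcc_of_le hle]
    exact hf_cont.log fun x hx => (hf_pos x hx).ne'
  have hquot : ContinuousOn (fun x => f x / x) (Set.uIcc a b) := by
    rw [Set.uIcc_of_le hle]
    exact hf_cont.div continuousOn_id fun x hx => (ha.trans_le hx.1).ne'
  have hinv : ContinuousOn (fun x : ℝ => x⁻¹) (Set.uIcc a b) := by
    rw [Set.uIcc_of_le hle]
    exact continuousOn_id.inv₀ fun x hx => (ha.trans_le hx.1).ne'
  obtain ⟨v, hv, hv_avg⟩ := exists_eq_interval_average hab.ne hlog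
  rw [Set.uIoo_of_le hle] at hv
  replace hv := Set.Ioo_subset_Icc_self hv
  rw [interval_average_eq, smul_eq_mul] at hv_avg
  have hfv := hf_pos v hv
  have hv_pos : 0 < v := ha.trans_le hv.1
  rw [← hv_avg, Real.exp_log hfv, ← div_eq_inv_mul,
    le_div_iff₀ (sub_pos.2 (Real.log_lt_log ha hab))]
  have hpoint : ∀ u ∈ Set.Icc a b,
      f v * u⁻¹ + f v / v * (Real.log (f u) - Real.log (f v)) ≤ f u / u := by
    intro u hu
    have hu_pos : 0 < u := ha.trans_le hu.1
    have h := hcond u hu v hv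
    rw [Real.log_div (hf_pos u hu).ne' hfv.ne'] at h
    have h' := mul_nonneg (div_pos hfv hu_pos).le h
    have heq : f v / u * (f u / f v - u / v * (Real.log (f u) - Real.log (f v)) - 1) =
        f u / u - (f v * u⁻¹ + f v / v * (Real.log (f u) - Real.log (f v))) := by
      field_simp
      ring
    linarith
  have hlogdev : IntervalIntegrable (fun u => f v / v * (Real.log (f u) - Real.log (f v)))
      MeasureTheory.volume a b :=
    (continuousOn_const.mul (hlog.sub continuousOn_const)).intervalIntegrable
  have hmain : IntervalIntegrable (fun u => f v * u⁻¹) MeasureTheory.volume a b :=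
    (continuousOn_const.mul hinv).intervalIntegrable
  have hint := intervalIntegral.integral_mono_on hle (hmain.add hlogdev)
    hquot.intervalIntegrable hpoint
  have hdev : ∫ u in a..b, (Real.log (f u) - Real.log (f v)) = 0 := by
    rw [intervalIntegral.integral_sub hlog.intervalIntegrable intervalIntegrable_const,
      intervalIntegral.integral_const, smul_eq_mul, hv_avg,
      mul_inv_cancel_left₀ (sub_pos.2 hab).ne', sub_self]
  rwa [intervalIntegral.integral_add hmain hlogdev, intervalIntegral.integral_const_mul,
    intervalIntegral.integral_const_mul, hdev, mul_zero, add_zero,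
    integral_inv_of_pos ha (ha.trans hab), Real.log_div (ha.trans hab).ne' ha.ne'] at hint
end

section
/- Let f be a positive, twice continuously differentiable, strictly decreasing function on [a,b] with 0 < a < b. Then the geometric mean of f on [a,b] is at most its elastic mean: exp( (1/(b−a)) ∫_a^b ln f(x) dx ) ≤ (1/(ln b − ln a)) ∫_a^b (f(x)/x) dx. -/
/-- The logarithmic mean of `a < b` lies in `[a, b]`. -/
theorem logarithmicMean_mem_Icc {a b : ℝ} (ha : 0 < a) (hab : a < b) :
    (b - a) / (Real.log b - Real.log a) ∈ Set.Icc a b := by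
  have hb : 0 < b := ha.trans hab
  have hD : 0 < Real.log b - Real.log a := sub_pos.2 (Real.log_lt_log ha hab)
  have hupper := Real.log_le_sub_one_of_pos (div_pos hb ha)
  have hlower := Real.one_sub_inv_le_log_of_pos (div_pos hb ha)
  rw [Real.log_div hb.ne' ha.ne'] at hupper hlower
  constructor
  · rw [le_div_iff₀ hD]
    calc a * (Real.log b - Real.log a) ≤ a * (b / a - 1) := by gcongr
      _ = b - a := by field_simp
  · rw [div_le_iff₀ hD]
    calc b - a = b * (1 - (b / a)⁻¹) := by field_simp
      _ ≤ b * (Real.log b - Real.log a) := by gcongr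

/-- The arithmetic mean of a decreasing function is at most its elastic mean. -/
theorem arithmeticMean_le_elasticMean {a b : ℝ} (ha : 0 < a) (hab : a < b) {f : ℝ → ℝ}
    (hf : ContinuousOn f (Set.Icc a b)) (hf_anti : AntitoneOn f (Set.Icc a b)) :
    (b - a)⁻¹ * ∫ x in a..b, f x ≤
      (Real.log b - Real.log a)⁻¹ * ∫ x in a..b, f x / x := by
  have hb : 0 < b := ha.trans hab
  have hD : 0 < Real.log b - Real.log a := sub_pos.2 (Real.log_lt_log ha hab)
  have hba : 0 < b - a := sub_pos.2 hab
  have hL := logarithmicMean_mem_Icc ha hab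
  set L := (b - a) / (Real.log b - Real.log a) with hLdef
  have hL0 : 0 < L := ha.trans_le hL.1
  have hinv : ContinuousOn (fun x : ℝ => x⁻¹) (Set.Icc a b) :=
    continuousOn_id.inv₀ fun x hx => (ha.trans_le hx.1).ne'
  have hfi : IntervalIntegrable f MeasureTheory.volume a b :=
    hf.intervalIntegrable_of_Icc hab.le
  have hinvi : IntervalIntegrable (fun x : ℝ => x⁻¹) MeasureTheory.volume a b :=
    hinv.intervalIntegrable_of_Icc hab.le
  have hfdi : IntervalIntegrable (fun x => f x / x) MeasureTheory.volume a b := by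
    simp only [div_eq_mul_inv]
    exact (hf.mul hinv).intervalIntegrable_of_Icc hab.le
  have hpoint : ∀ x ∈ Set.Icc a b, L⁻¹ * f x + f L * (x⁻¹ - L⁻¹) ≤ f x / x := by
    intro x hx
    have hx0 : 0 < x := ha.trans_le hx.1
    have key : 0 ≤ (f x - f L) * (x⁻¹ - L⁻¹) := by
      rcases le_total x L with h | h
      · exact mul_nonneg (sub_nonneg.2 (hf_anti hx hL h)) (sub_nonneg.2 (inv_anti₀ hx0 h))
      · exact mul_nonneg_of_nonpos_of_nonpos (sub_nonpos.2 (hf_anti hL hx h))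
          (sub_nonpos.2 (inv_anti₀ hL0 h))
    rw [div_eq_mul_inv]
    linarith
  have hweight : IntervalIntegrable (fun x : ℝ => x⁻¹ - L⁻¹) MeasureTheory.volume a b :=
    hinvi.sub intervalIntegrable_const
  have hint := intervalIntegral.integral_mono_on hab.le
    ((hfi.const_mul L⁻¹).add (hweight.const_mul (f L))) hfdi hpoint
  rw [intervalIntegral.integral_add (hfi.const_mul _) (hweight.const_mul _),
    intervalIntegral.integral_const_mul, intervalIntegral.integral_const_mul,
    intervalIntegral.integral_sub hinvi intervalIntegrable_const,
    integral_inv_of_pos ha hb, intervalIntegral.integral_const, smul_eq_mul,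
    Real.log_div hb.ne' ha.ne', hLdef, inv_div, mul_div_cancel₀ _ hba.ne', sub_self,
    mul_zero, add_zero] at hint
  calc (b - a)⁻¹ * ∫ x in a..b, f x
      = (Real.log b - Real.log a)⁻¹ *
          ((Real.log b - Real.log a) / (b - a) * ∫ x in a..b, f x) := by field_simp
    _ ≤ _ := by gcongr

/-- The geometric mean of a positive continuous function is at most its arithmetic mean. -/
theorem geometricMean_le_arithmeticMean {a b : ℝ} (hab : a < b) {f : ℝ → ℝ}
    (hf_pos : ∀ x ∈ Set.Icc a b, 0 < f x) (hf : ContinuousOn f (Set.Icc a b)) :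
    Real.exp ((b - a)⁻¹ * ∫ x in a..b, Real.log (f x)) ≤ (b - a)⁻¹ * ∫ x in a..b, f x := by
  have hba : 0 < b - a := sub_pos.2 hab
  have hfi : IntervalIntegrable f MeasureTheory.volume a b :=
    hf.intervalIntegrable_of_Icc hab.le
  have hlog : IntervalIntegrable (fun x => Real.log (f x)) MeasureTheory.volume a b :=
    (hf.log fun x hx => (hf_pos x hx).ne').intervalIntegrable_of_Icc hab.le
  have hI : 0 < ∫ x in a..b, f x :=
    intervalIntegral.intervalIntegral_pos_of_pos_on hfi
      (fun x hx => hf_pos x (Set.Ioo_subset_Icc_self hx)) hab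
  set A := (b - a)⁻¹ * ∫ x in a..b, f x with hA
  have hA0 : 0 < A := mul_pos (inv_pos.2 hba) hI
  have hpoint : ∀ x ∈ Set.Icc a b, Real.log (f x) ≤ A⁻¹ * f x + (Real.log A - 1) := by
    intro x hx
    have h := Real.log_le_sub_one_of_pos (div_pos (hf_pos x hx) hA0)
    rw [Real.log_div (hf_pos x hx).ne' hA0.ne', div_eq_inv_mul] at h
    linarith
  have hint := intervalIntegral.integral_mono_on hab.le hlog
    ((hfi.const_mul A⁻¹).add intervalIntegrable_const) hpoint
  have hmean : ∫ x in a..b, f x = (b - a) * A := by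
    rw [hA, mul_inv_cancel_left₀ hba.ne']
  rw [intervalIntegral.integral_add (hfi.const_mul _) intervalIntegrable_const,
    intervalIntegral.integral_const_mul, intervalIntegral.integral_const, smul_eq_mul,
    hmean, mul_left_comm, inv_mul_cancel₀ hA0.ne'] at hint
  rw [← Real.le_log_iff_exp_le hA0, inv_mul_le_iff₀ hba]
  linarith

/-- for a positive `C²` strictly decreasing function on `[a,b]`
(0 < a < b), the geometric mean is at most the elastic mean. -/
theorem stmt_17 {a b : ℝ} (ha : 0 < a) (hab : a < b) {f : ℝ → ℝ}
    (hf_pos : ∀ x ∈ Set.Icc a b, 0 < f x)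
    (hf_c2 : ContDiffOn ℝ 2 f (Set.Icc a b))
    (hf_anti : StrictAntiOn f (Set.Icc a b)) :
    Real.exp ((b - a)⁻¹ * ∫ x in a..b, Real.log (f x)) ≤
      (Real.log b - Real.log a)⁻¹ * ∫ x in a..b, f x / x :=
  (geometricMean_le_arithmeticMean hab hf_pos hf_c2.continuousOn).trans
    (arithmeticMean_le_elasticMean ha hab hf_c2.continuousOn hf_anti.antitoneOn)
end

section
/- For p ≠ 0 define S : (0,∞) → ℝ by S(r) = r^p − p·r·ln r − 1. Then S(1) = 0, and: (1) if p < 0, then S(r) ≥ 0 for all r > 0 and r = 1 is the only root of S; (2) if p > 2, there is a unique α ∈ (0,1) with S(α) = 0, and S(r) < 0 for r ∈ (0,α) while S(r) ≥ 0 for r ∈ [α,∞); (3) if 1 < p < 2, there is a unique β > 1 with S(β) = 0, and S(r) ≤ 0 for r ∈ (0,β] while S(r) > 0 for r ∈ (β,∞); (4) if 0 < p ≤ 1, then S(r) ≤ 0 for all r > 0 and r = 1 is the only root; (5) if p = 2, then S(r) < 0 for r ∈ (0,1) and S(r) > 0 for r ∈ (1,∞). -/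
/-- A strictly convex function with a critical point at `x` exceeds its value at `x` everywhere
else. -/
theorem StrictConvexOn.lt_of_hasDerivAt_zero {s : Set ℝ} {f : ℝ → ℝ} {x y : ℝ}
    (hf : StrictConvexOn ℝ s f) (hx : x ∈ s) (hd : HasDerivAt f 0 x) (hy : y ∈ s) (hne : y ≠ x) :
    f x < f y := by
  rcases lt_or_gt_of_ne hne with h | h
  · have := hf.slope_lt_of_hasDerivAt hy hx h hd
    rw [slope_def_field, div_neg_iff] at this
    rcases this with h' | h' <;> linarith [h'.1, h'.2]
  · have := hf.lt_slope_of_hasDerivAt hx hy h hd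
    rw [slope_def_field, div_pos_iff] at this
    rcases this with h' | h' <;> linarith [h'.1, h'.2]

/-- A strictly concave function with a critical point at `x` is below its value at `x` everywhere
else. -/
theorem StrictConcaveOn.lt_of_hasDerivAt_zero {s : Set ℝ} {f : ℝ → ℝ} {x y : ℝ}
    (hf : StrictConcaveOn ℝ s f) (hx : x ∈ s) (hd : HasDerivAt f 0 x) (hy : y ∈ s) (hne : y ≠ x) :
    f y < f x := by
  have hd' : HasDerivAt (-f) 0 x := by simpa using hd.neg
  simpa using hf.neg.lt_of_hasDerivAt_zero hx hd' hy hne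

/-- The function `r ↦ r ^ p - p * r * log r - 1`. -/
noncomputable def powSubMulLog (p r : ℝ) : ℝ := r ^ p - p * r * Real.log r - 1

namespace powSubMulLog

theorem apply_one (p : ℝ) : powSubMulLog p 1 = 0 := by simp [powSubMulLog]

theorem apply_zero {p : ℝ} (hp : p ≠ 0) : powSubMulLog p 0 = -1 := by
  simp [powSubMulLog, Real.zero_rpow hp]

theorem continuous {p : ℝ} (hp : 0 ≤ p) : Continuous (powSubMulLog p) := by
  have h1 : Continuous fun r : ℝ => r ^ p := Real.continuous_rpow_const hp
  have h2 : Continuous fun r : ℝ => p * (r * Real.log r) :=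
    continuous_const.mul Real.continuous_mul_log
  refine ((h1.sub h2).sub (continuous_const (y := (1 : ℝ)))).congr fun r => ?_
  simp [powSubMulLog, mul_assoc]

theorem hasDerivAt (p : ℝ) {r : ℝ} (hr : 0 < r) :
    HasDerivAt (powSubMulLog p) (p * (r ^ (p - 1) - Real.log r - 1)) r := by
  have h1 := Real.hasDerivAt_rpow_const (p := p) (Or.inl hr.ne')
  have h2 := ((hasDerivAt_id r).const_mul p).mul (Real.hasDerivAt_log hr.ne')
  refine ((h1.sub h2).sub_const 1).congr_deriv ?_
  simp only [id]
  field_simp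
  ring

theorem hasDerivAt_one (p : ℝ) : HasDerivAt (powSubMulLog p) 0 1 := by
  simpa using hasDerivAt p one_pos

theorem deriv_two (p : ℝ) {r : ℝ} (hr : 0 < r) :
    deriv^[2] (powSubMulLog p) r = p / r * ((p - 1) * r ^ (p - 1) - 1) := by
  have h : deriv (powSubMulLog p) =ᶠ[nhds r] fun r => p * (r ^ (p - 1) - Real.log r - 1) := by
    filter_upwards [lt_mem_nhds hr] with x hx using (hasDerivAt p hx).deriv
  have h1 := Real.hasDerivAt_rpow_const (p := p - 1) (Or.inl hr.ne')
  have h2 := ((h1.sub (Real.hasDerivAt_log hr.ne')).sub_const 1).const_mul p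
  simp only [Function.iterate_succ, Function.iterate_zero, Function.comp_apply, id]
  rw [h.deriv_eq]
  refine h2.deriv.trans ?_
  rw [Real.rpow_sub_one hr.ne' (p - 1)]
  field_simp

theorem strictConvexOn_of_neg {p : ℝ} (hp : p < 0) :
    StrictConvexOn ℝ (Set.Ioi 0) (powSubMulLog p) := by
  refine strictConvexOn_of_deriv2_pos (convex_Ioi 0)
    (fun r hr => (hasDerivAt p hr).continuousAt.continuousWithinAt) fun r hr => ?_
  rw [interior_Ioi] at hr
  rw [deriv_two p hr]
  have := Real.rpow_pos_of_pos hr (p - 1)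
  exact mul_pos_of_neg_of_neg (div_neg_of_neg_of_pos hp hr) (by nlinarith)

theorem strictConcaveOn_of_le_one {p : ℝ} (hp : 0 < p) (hp1 : p ≤ 1) :
    StrictConcaveOn ℝ (Set.Ioi 0) (powSubMulLog p) := by
  refine strictConcaveOn_of_deriv2_neg (convex_Ioi 0)
    (fun r hr => (hasDerivAt p hr).continuousAt.continuousWithinAt) fun r hr => ?_
  rw [interior_Ioi] at hr
  rw [deriv_two p hr]
  have := Real.rpow_pos_of_pos hr (p - 1)
  exact mul_neg_of_pos_of_neg (div_pos hp hr) (by nlinarith)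

/-- The inflection point of `powSubMulLog p` for `1 < p`. -/
noncomputable def inflection (p : ℝ) : ℝ := (p - 1)⁻¹ ^ (p - 1)⁻¹

theorem inflection_pos {p : ℝ} (hp : 1 < p) : 0 < inflection p :=
  Real.rpow_pos_of_pos (inv_pos.2 (by linarith)) _

theorem inflection_rpow {p : ℝ} (hp : 1 < p) : inflection p ^ (p - 1) = (p - 1)⁻¹ :=
  Real.rpow_inv_rpow (inv_nonneg.2 (by linarith)) (by linarith)

theorem inflection_lt_one {p : ℝ} (hp : 2 < p) : inflection p < 1 :=
  Real.rpow_lt_one (inv_nonneg.2 (by linarith)) (inv_lt_one_of_one_lt₀ (by linarith))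
    (inv_pos.2 (by linarith))

theorem one_lt_inflection {p : ℝ} (hp : 1 < p) (hp2 : p < 2) : 1 < inflection p :=
  Real.one_lt_rpow ((one_lt_inv₀ (by linarith)).2 (by linarith)) (inv_pos.2 (by linarith))

theorem inflection_two : inflection 2 = 1 := by norm_num [inflection]

theorem strictConcaveOn_Icc {p : ℝ} (hp : 1 < p) :
    StrictConcaveOn ℝ (Set.Icc 0 (inflection p)) (powSubMulLog p) := by
  refine strictConcaveOn_of_deriv2_neg (convex_Icc _ _)
    (continuous (by linarith)).continuousOn fun r hr => ?_
  rw [interior_Icc] at hr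
  rw [deriv_two p hr.1]
  have h := Real.rpow_lt_rpow hr.1.le hr.2 (sub_pos.2 hp)
  rw [inflection_rpow hp, lt_inv_comm₀ (Real.rpow_pos_of_pos hr.1 _) (sub_pos.2 hp),
    ← one_div, lt_div_iff₀ (Real.rpow_pos_of_pos hr.1 _)] at h
  exact mul_neg_of_pos_of_neg (div_pos (by linarith) hr.1) (by linarith)

theorem strictConvexOn_Ici {p : ℝ} (hp : 1 < p) :
    StrictConvexOn ℝ (Set.Ici (inflection p)) (powSubMulLog p) := by
  refine strictConvexOn_of_deriv2_pos (convex_Ici _)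
    (continuous (by linarith)).continuousOn fun r hr => ?_
  rw [interior_Ici] at hr
  have hr0 : 0 < r := (inflection_pos hp).trans hr
  rw [deriv_two p hr0]
  have h := Real.rpow_lt_rpow (inflection_pos hp).le hr (sub_pos.2 hp)
  rw [inflection_rpow hp, inv_lt_iff_one_lt_mul₀' (sub_pos.2 hp)] at h
  exact mul_pos (div_pos (by linarith) hr0) (by linarith)

theorem exists_pos_of_one_lt {p : ℝ} (hp : 1 < p) (a : ℝ) :
    ∃ r, a < r ∧ 0 < powSubMulLog p r := by
  have hlog := (isLittleO_log_rpow_atTop (sub_pos.2 hp)).bound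
    (c := (2 * p)⁻¹) (by positivity)
  have hlarge := (tendsto_rpow_atTop (show 0 < p by linarith)).eventually_gt_atTop 2
  obtain ⟨r, hr, hr2, hra, hr1⟩ := (hlog.and (hlarge.and
    ((Filter.eventually_gt_atTop a).and (Filter.eventually_gt_atTop 1)))).exists
  refine ⟨r, hra, ?_⟩
  have hr0 : 0 < r := by linarith
  rw [Real.norm_of_nonneg (Real.log_nonneg hr1.le),
    Real.norm_of_nonneg (Real.rpow_nonneg hr0.le _)] at hr
  have hmul : p * r * Real.log r ≤ p * r * ((2 * p)⁻¹ * r ^ (p - 1)) :=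
    mul_le_mul_of_nonneg_left hr (by positivity)
  have heq : p * r * ((2 * p)⁻¹ * r ^ (p - 1)) = r ^ p / 2 := by
    rw [Real.rpow_sub_one hr0.ne']
    field_simp
  unfold powSubMulLog
  linarith

theorem exists_root_of_two_lt {p : ℝ} (hp : 2 < p) :
    ∃ α ∈ Set.Ioo (0 : ℝ) 1, powSubMulLog p α = 0 ∧
      (∀ r, 0 < r → r < α → powSubMulLog p r < 0) ∧
      (∀ r, α < r → r ≠ 1 → 0 < powSubMulLog p r) := by
  have hp1 : 1 < p := by linarith
  have h0 := inflection_pos hp1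
  have h1 := inflection_lt_one hp
  have hright : ∀ r, inflection p ≤ r → r ≠ 1 → 0 < powSubMulLog p r := fun r hr hne => by
    simpa [apply_one] using
      (strictConvexOn_Ici hp1).lt_of_hasDerivAt_zero h1.le (hasDerivAt_one p) hr hne
  have hpos := hright _ le_rfl h1.ne
  obtain ⟨α, hα, hroot⟩ := intermediate_value_Ioo h0.le
    (continuous (p := p) (by linarith)).continuousOn
    (show (0 : ℝ) ∈ Set.Ioo _ _ from ⟨by rw [apply_zero (by linarith)]; norm_num, hpos⟩)
  refine ⟨α, ⟨hα.1, hα.2.trans h1⟩, hroot, fun r hr hrα => ?_, fun r hr hne => ?_⟩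
  · by_contra! hn
    have := (strictConcaveOn_Icc hp1).lt_on_openSegment (x := r) (y := inflection p) (z := α)
      ⟨hr.le, (hrα.trans hα.2).le⟩ ⟨h0.le, le_rfl⟩ (hrα.trans hα.2).ne
      (by rw [openSegment_eq_Ioo (hrα.trans hα.2)]; exact ⟨hrα, hα.2⟩)
    rw [hroot] at this
    exact absurd (le_min hn hpos.le) this.not_ge
  · rcases le_or_gt (inflection p) r with h | h
    · exact hright r h hne
    · have := (strictConcaveOn_Icc hp1).lt_on_openSegment (x := α) (y := inflection p) (z := r)
        ⟨hα.1.le, hα.2.le⟩ ⟨h0.le, le_rfl⟩ hα.2.ne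
        (by rw [openSegment_eq_Ioo hα.2]; exact ⟨hr, h⟩)
      rwa [hroot, min_eq_left hpos.le] at this

theorem exists_root_of_lt_two {p : ℝ} (hp1 : 1 < p) (hp : p < 2) :
    ∃ β, 1 < β ∧ powSubMulLog p β = 0 ∧
      (∀ r, 0 < r → r < β → r ≠ 1 → powSubMulLog p r < 0) ∧
      (∀ r, β < r → 0 < powSubMulLog p r) := by
  have h1 := one_lt_inflection hp1 hp
  have hleft : ∀ r, 0 < r → r ≤ inflection p → r ≠ 1 → powSubMulLog p r < 0 :=
    fun r h0 hr hne => by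
      simpa [apply_one] using (strictConcaveOn_Icc hp1).lt_of_hasDerivAt_zero
        ⟨zero_le_one, h1.le⟩ (hasDerivAt_one p) ⟨h0.le, hr⟩ hne
  have hneg := hleft _ (inflection_pos hp1) le_rfl h1.ne'
  obtain ⟨b, hb, hbpos⟩ := exists_pos_of_one_lt hp1 (inflection p)
  obtain ⟨β, hβ, hroot⟩ := intermediate_value_Ioo hb.le
    (continuous (p := p) (by linarith)).continuousOn
    (show (0 : ℝ) ∈ Set.Ioo _ _ from ⟨hneg, hbpos⟩)
  refine ⟨β, h1.trans hβ.1, hroot, fun r h0 hr hne => ?_, fun r hr => ?_⟩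
  · rcases le_or_gt r (inflection p) with h | h
    · exact hleft r h0 h hne
    · have := (strictConvexOn_Ici hp1).lt_on_openSegment (x := inflection p) (y := β) (z := r)
        Set.self_mem_Ici hβ.1.le hβ.1.ne
        (by rw [openSegment_eq_Ioo hβ.1]; exact ⟨h, hr⟩)
      rwa [hroot, max_eq_right hneg.le] at this
  · by_contra! hn
    have := (strictConvexOn_Ici hp1).lt_on_openSegment (x := inflection p) (y := r) (z := β)
      Set.self_mem_Ici (hβ.1.trans hr).le (hβ.1.trans hr).ne
      (by rw [openSegment_eq_Ioo (hβ.1.trans hr)]; exact ⟨hβ.1, hr⟩)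
    rw [hroot] at this
    exact absurd (max_le hneg.le hn) this.not_ge

end powSubMulLog

/-- sign analysis of `S(r) = r^p − p·r·ln r − 1` on `(0,∞)` for
the various ranges of the nonzero parameter `p`. -/
theorem stmt_18 {p : ℝ} (hp : p ≠ 0) {S : ℝ → ℝ}
    (hS : S = fun r : ℝ => r ^ p - p * r * Real.log r - 1) :
    S 1 = 0 ∧
    (p < 0 →
      (∀ r : ℝ, 0 < r → 0 ≤ S r) ∧ (∀ r : ℝ, 0 < r → S r = 0 → r = 1)) ∧
    (2 < p →
      ∃ α : ℝ, α ∈ Set.Ioo (0 : ℝ) 1 ∧ S α = 0 ∧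
        (∀ α' ∈ Set.Ioo (0 : ℝ) 1, S α' = 0 → α' = α) ∧
        (∀ r : ℝ, 0 < r → r < α → S r < 0) ∧
        (∀ r : ℝ, α ≤ r → 0 ≤ S r)) ∧
    (1 < p → p < 2 →
      ∃ β : ℝ, 1 < β ∧ S β = 0 ∧
        (∀ β' : ℝ, 1 < β' → S β' = 0 → β' = β) ∧
        (∀ r : ℝ, 0 < r → r ≤ β → S r ≤ 0) ∧
        (∀ r : ℝ, β < r → 0 < S r)) ∧
    (0 < p → p ≤ 1 →
      (∀ r : ℝ, 0 < r → S r ≤ 0) ∧ (∀ r : ℝ, 0 < r → S r = 0 → r = 1)) ∧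
    (p = 2 →
      (∀ r ∈ Set.Ioo (0 : ℝ) 1, S r < 0) ∧ (∀ r : ℝ, 1 < r → 0 < S r)) := by
  obtain rfl : S = powSubMulLog p := hS
  have hone := powSubMulLog.apply_one p
  have hd := powSubMulLog.hasDerivAt_one p
  refine ⟨hone, fun hneg => ?_, fun h2 => ?_, fun h1 h2 => ?_, fun h0 h1 => ?_, ?_⟩
  · have key : ∀ r, 0 < r → r ≠ 1 → 0 < powSubMulLog p r := fun r hr hne => hone ▸
      (powSubMulLog.strictConvexOn_of_neg hneg).lt_of_hasDerivAt_zero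
        (Set.mem_Ioi.2 one_pos) hd hr hne
    refine ⟨fun r hr => ?_, fun r hr h => by_contra fun hne => (key r hr hne).ne' h⟩
    rcases eq_or_ne r 1 with rfl | hne
    exacts [hone.ge, (key r hr hne).le]
  · obtain ⟨α, hα, hroot, hlt, hgt⟩ := powSubMulLog.exists_root_of_two_lt h2
    refine ⟨α, hα, hroot, fun x hx h => ?_, hlt, fun r hr => ?_⟩
    · rcases lt_trichotomy x α with hl | he | hg
      exacts [absurd h (hlt x hx.1 hl).ne, he, absurd h (hgt x hg hx.2.ne).ne']
    · rcases eq_or_ne r 1 with rfl | hne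
      · exact hone.ge
      · rcases hr.eq_or_lt with rfl | hr
        exacts [hroot.ge, (hgt r hr hne).le]
  · obtain ⟨β, hβ, hroot, hlt, hgt⟩ := powSubMulLog.exists_root_of_lt_two h1 h2
    refine ⟨β, hβ, hroot, fun x hx h => ?_, fun r h0 hr => ?_, hgt⟩
    · rcases lt_trichotomy x β with hl | he | hg
      exacts [absurd h (hlt x (by linarith) hl hx.ne').ne, he, absurd h (hgt x hg).ne']
    · rcases eq_or_ne r 1 with rfl | hne
      · exact hone.le
      · rcases hr.eq_or_lt with rfl | hr
        exacts [hroot.le, (hlt r h0 hr hne).le]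
  · have key : ∀ r, 0 < r → r ≠ 1 → powSubMulLog p r < 0 := fun r hr hne => hone ▸
      (powSubMulLog.strictConcaveOn_of_le_one h0 h1).lt_of_hasDerivAt_zero
        (Set.mem_Ioi.2 one_pos) hd hr hne
    refine ⟨fun r hr => ?_, fun r hr h => by_contra fun hne => (key r hr hne).ne h⟩
    rcases eq_or_ne r 1 with rfl | hne
    exacts [hone.le, (key r hr hne).le]
  · rintro rfl
    have hcave := powSubMulLog.strictConcaveOn_Icc (p := 2) one_lt_two
    have hvex := powSubMulLog.strictConvexOn_Ici (p := 2) one_lt_two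
    rw [powSubMulLog.inflection_two] at hcave hvex
    exact ⟨fun r hr => hone ▸ hcave.lt_of_hasDerivAt_zero ⟨zero_le_one, le_rfl⟩ hd
        ⟨hr.1.le, hr.2.le⟩ hr.2.ne,
      fun r hr => hone ▸ hvex.lt_of_hasDerivAt_zero Set.self_mem_Ici hd hr.le hr.ne'⟩
end

section
/- For all real numbers 0 < a < b, exp( 2·( (b·ln b − a·ln a)/(b − a) − 1 ) ) > ((a + b)/2) · ((b − a)/(ln b − ln a)); equivalently, the geometric mean of f(x) = x² on [a,b] is strictly greater than its elastic mean, i.e. the square of the identric mean of a and b strictly exceeds the product of the arithmetic mean and the logarithmic mean of a and b. -/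
open Real Set Filter Topology

theorem pos_of_hasDerivAt_pos {f f' : ℝ → ℝ} (h0 : f 0 = 0)
    (hf : ∀ x, HasDerivAt f (f' x) x) (hf' : ∀ x, 0 < x → 0 < f' x) {x : ℝ} (hx : 0 < x) :
    0 < f x := by
  have hmono : StrictMonoOn f (Ici 0) := by
    apply strictMonoOn_of_deriv_pos (convex_Ici 0)
    · exact fun y _ => (hf y).continuousAt.continuousWithinAt
    · intro y hy
      rw [interior_Ici] at hy
      rw [(hf y).deriv]
      exact hf' y hy
  simpa [h0] using hmono self_mem_Ici hx.le hx

theorem sinh_lt_mul_cosh {t : ℝ} (ht : 0 < t) : sinh t < t * cosh t := by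
  have h := pos_of_hasDerivAt_pos (f := fun t => t * cosh t - sinh t)
    (f' := fun t => t * sinh t) (by simp)
    (fun x => (((hasDerivAt_id x).mul (hasDerivAt_cosh x)).sub (hasDerivAt_sinh x)).congr_deriv
      (by simp))
    (fun x hx => mul_pos hx (sinh_pos_iff.2 hx)) ht
  simpa using h

theorem lt_sinh_mul_cosh {t : ℝ} (ht : 0 < t) : t < sinh t * cosh t := by
  have h1 : t < sinh t := self_lt_sinh_iff.2 ht
  nlinarith [one_le_cosh t]

/-- The hyperbolic analogue of Wilker's inequality. -/
theorem two_mul_sq_lt_sinh_sq_add_mul_tanh {t : ℝ} (ht : 0 < t) :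
    2 * t ^ 2 < sinh t ^ 2 + t * (sinh t / cosh t) := by
  have key : ∀ x : ℝ, 0 < x →
      0 < 2 * sinh x * cosh x ^ 3 + sinh x * cosh x + x - 4 * x * cosh x ^ 2 := by
    intro x hx
    refine pos_of_hasDerivAt_pos
      (f := fun x => 2 * sinh x * cosh x ^ 3 + sinh x * cosh x + x - 4 * x * cosh x ^ 2)
      (f' := fun x => 8 * (sinh x * cosh x) * (sinh x * cosh x - x)) (by simp) ?_ ?_ hx
    · intro y
      have hs := hasDerivAt_sinh y
      have hc := hasDerivAt_cosh y
      refine (((((hs.const_mul 2).mul (hc.pow 3)).add (hs.mul hc)).add (hasDerivAt_id y)).sub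
        (((hasDerivAt_id y).const_mul 4).mul (hc.pow 2))).congr_deriv ?_
      have h := cosh_sq y
      simp only [Pi.pow_apply, id]
      push_cast
      have h4 : cosh y ^ 4 = (sinh y ^ 2 + 1) ^ 2 := by rw [← h]; ring
      ring_nf
      simp only [h, h4]
      ring
    · intro y hy
      have h1 := sinh_pos_iff.2 hy
      have h2 := lt_sinh_mul_cosh hy
      have h3 := cosh_pos y
      have h4 : 0 < sinh y * cosh y - y := by linarith
      positivity
  have h := pos_of_hasDerivAt_pos
    (f := fun x => sinh x ^ 2 + x * (sinh x / cosh x) - 2 * x ^ 2)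
    (f' := fun x => (2 * sinh x * cosh x ^ 3 + sinh x * cosh x + x - 4 * x * cosh x ^ 2)
      / cosh x ^ 2) (by simp) ?_ (fun x hx => div_pos (key x hx) (by positivity)) ht
  · simpa using h
  · intro y
    have hs := hasDerivAt_sinh y
    have hc := hasDerivAt_cosh y
    have hc0 := (cosh_pos y).ne'
    refine (((hs.pow 2).add ((hasDerivAt_id y).mul (hs.div hc hc0))).sub
      ((hasDerivAt_pow 2 y).const_mul 2)).congr_deriv ?_
    have h := cosh_sq y
    simp only [id, Pi.div_apply]
    field_simp
    push_cast
    have h4 : cosh y ^ 4 = (sinh y ^ 2 + 1) ^ 2 := by rw [← h]; ring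
    ring_nf
    simp only [h]
    ring

theorem sinh_mul_cosh_div_lt_exp {t : ℝ} (ht : 0 < t) :
    sinh t * cosh t / t < exp (2 * (t * cosh t / sinh t - 1)) := by
  let F : ℝ → ℝ := fun t =>
    2 * (t * cosh t / sinh t - 1) - (log (sinh t) + log (cosh t) - log t)
  have hmono : StrictMonoOn F (Ioi 0) := by
    have hd : ∀ y : ℝ, 0 < y → HasDerivAt F
        ((sinh y ^ 2 + y * (sinh y / cosh y) - 2 * y ^ 2) / (y * sinh y ^ 2)) y := by
      intro y hy
      have hs := hasDerivAt_sinh y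
      have hc := hasDerivAt_cosh y
      have hc0 := (cosh_pos y).ne'
      have hs0 := (sinh_pos_iff.2 hy).ne'
      refine (((((hasDerivAt_id y).mul hc).div hs hs0).sub_const 1).const_mul 2 |>.sub
        (((hs.log hs0).add (hc.log hc0)).sub (hasDerivAt_log hy.ne'))).congr_deriv ?_
      have h := cosh_sq y
      simp only [id, Pi.mul_apply]
      field_simp
      have h3 : cosh y ^ 3 = (sinh y ^ 2 + 1) * cosh y := by rw [← h]; ring
      ring_nf
      simp only [h, h3]
      ring
    apply strictMonoOn_of_deriv_pos (convex_Ioi 0)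
    · exact fun y hy => (hd y hy).continuousAt.continuousWithinAt
    · intro y hy
      rw [interior_Ioi] at hy
      have hy' : 0 < y := hy
      rw [(hd y hy).deriv]
      have h1 := sinh_pos_iff.2 hy'
      have h2 := two_mul_sq_lt_sinh_sq_add_mul_tanh hy'
      exact div_pos (by linarith) (by positivity)
  have hlower : ∀ y : ℝ, 0 < y → -2 * log (cosh y) ≤ F y := by
    intro y hy
    have h1 := sinh_pos_iff.2 hy
    have h2 := sinh_lt_mul_cosh hy
    have h3 : 1 ≤ y * cosh y / sinh y := (one_le_div h1).2 h2.le
    have h4 : log (sinh y) ≤ log y + log (cosh y) := by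
      rw [← log_mul hy.ne' (cosh_pos y).ne']
      exact log_le_log h1 h2.le
    simp only [F]
    linarith
  have hnonneg : ∀ y : ℝ, 0 < y → 0 ≤ F y := by
    intro y hy
    have hlim : Tendsto (fun x => -2 * log (cosh x)) (𝓝[>] 0) (𝓝 0) := by
      have hcont : ContinuousAt (fun x => -2 * log (cosh x)) 0 :=
        (continuous_cosh.continuousAt.log (cosh_pos 0).ne').const_mul (-2)
      have := hcont.tendsto
      simp only [cosh_zero, log_one, mul_zero] at this
      exact this.mono_left nhdsWithin_le_nhds
    refine le_of_tendsto hlim ?_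
    filter_upwards [Ioo_mem_nhdsGT hy] with x hx
    exact (hlower x hx.1).trans (hmono hx.1 hy hx.2).le
  have hF : 0 < F t :=
    (hnonneg (t / 2) (half_pos ht)).trans_lt (hmono (half_pos ht) ht (half_lt_self ht))
  have h1 := sinh_pos_iff.2 ht
  have h2 := cosh_pos t
  rw [← log_lt_iff_lt_exp (by positivity), log_div (by positivity) ht.ne',
    log_mul h1.ne' h2.ne']
  simp only [F] at hF
  linarith

/-- for `0 < a < b`, the square of the identric mean of `a, b`
(the geometric mean of `x²` on `[a,b]`) strictly exceeds the product of the
arithmetic and logarithmic means (the elastic mean of `x²` on `[a,b]`). -/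
theorem stmt_19 :
    ∀ a b : ℝ, 0 < a → a < b →
      ((a + b) / 2) * ((b - a) / (Real.log b - Real.log a)) <
        Real.exp (2 * ((b * Real.log b - a * Real.log a) / (b - a) - 1)) := by
  intro a b ha hab
  obtain ⟨g, t, ht, rfl, rfl⟩ : ∃ g t : ℝ, 0 < t ∧ a = exp (g - t) ∧ b = exp (g + t) := by
    refine ⟨(log b + log a) / 2, (log b - log a) / 2, ?_, ?_, ?_⟩
    · linarith [log_lt_log ha hab]
    · ring_nf
      rw [exp_log ha]
    · ring_nf
      rw [exp_log (ha.trans hab)]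
  have hs := sinh_pos_iff.2 ht
  have ha' : exp (g - t) = exp g * (cosh t - sinh t) := by
    rw [cosh_sub_sinh, ← exp_add, sub_eq_add_neg]
  have hb' : exp (g + t) = exp g * (cosh t + sinh t) := by
    rw [cosh_add_sinh, ← exp_add]
  have hg := exp_pos g
  have hexp : 2 * ((exp (g + t) * (g + t) - exp (g - t) * (g - t)) / (exp (g + t) - exp (g - t)) - 1)
      = (g + g) + 2 * (t * cosh t / sinh t - 1) := by
    have hsub : exp (g + t) - exp (g - t) = exp g * (2 * sinh t) := by rw [ha', hb']; ring
    rw [hsub, ha', hb']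
    field_simp
    ring
  have hlhs : (exp (g - t) + exp (g + t)) / 2 * ((exp (g + t) - exp (g - t)) / (g + t - (g - t)))
      = exp g * exp g * (sinh t * cosh t / t) := by
    have hden : g + t - (g - t) = 2 * t := by ring
    rw [hden, ha', hb']
    field_simp
    ring
  rw [log_exp, log_exp, hexp, hlhs, exp_add, exp_add]
  exact mul_lt_mul_of_pos_left (sinh_mul_cosh_div_lt_exp ht) (by positivity)
end
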